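/- arXiv:1808.04275 — 2 statements merged into one kernel-verified Lean document; each statement's English description precedes it below -/
import Mathlib

section
/- Define, for n ≥ 1 and 0 ≤ k ≤ n−1, e_{n,k} = Σ_{T ∈ T_n^e with max(T) = k} 2^{fr(T) − 1 − k} (a nonnegative integer, since fr(T) ≥ max(T)+1). Then for every n ≥ 2: (i) e_{n,0} = Σ_{i=0}^{n−2} 2^i·e_{n−1,i}; (ii) for every k with 1 ≤ k ≤ n−2, e_{n,k} = (k+1)·e_{n−1,k−1} + Σ_{i=k}^{n−2} 2^{i−k}·( binom(i+1,k) + 2·binom(i+1,k−1) )·e_{n−1,i}; (iii) e_{n,n−1} = n·e_{n−1,n−2}. Here binom denotes the binomial coefficient. -/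
open scoped Classical

namespace SymDellac

/-- The polynomials `P n` (for `n ≥ 1`) defined by `P 1 = 1` and
`P (n+1) (x) = ((x+2)(x+1)/2) P n (x+2) - (x(x-1)/2) P n (x)`. -/
noncomputable def P : ℕ → Polynomial ℚ
  | 0 => 1
  | 1 => 1
  | n + 2 =>
      Polynomial.C (1/2 : ℚ) *
        ((Polynomial.X + 2) * (Polynomial.X + 1) * ((P (n+1)).comp (Polynomial.X + 2))
          - Polynomial.X * (Polynomial.X - 1) * (P (n+1)))

/-- The polynomials `D n` defined by `D 0 = 1` and
`D (n+1) (x) = (x+1)(x+2) D n (x+2) - x(x+1) D n (x)`. -/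
noncomputable def D : ℕ → Polynomial ℚ
  | 0 => 1
  | n + 1 =>
      (Polynomial.X + 1) * (Polynomial.X + 2) * ((D n).comp (Polynomial.X + 2))
        - Polynomial.X * (Polynomial.X + 1) * (D n)

/-! ### Even extended Dellac configurations -/

/-- `T` is an even extended Dellac configuration of size `n`. -/
def IsTne (n : ℕ) (T : Finset (ℕ × ℕ)) : Prop :=
  (∀ p ∈ T, 1 ≤ p.1 ∧ p.1 ≤ n ∧ 1 ≤ p.2 ∧ p.2 ≤ 2*n ∧ p.1 ≤ p.2) ∧
  (∀ i ∈ Finset.Icc 1 (2*n), (T.filter (fun p => p.2 = i)).card = 1) ∧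
  (∀ j ∈ Finset.Icc 1 n, (T.filter (fun p => p.1 = j)).card = 2)

/-- The finite set of even extended Dellac configurations of size `n`. -/
noncomputable def TneF (n : ℕ) : Finset (Finset (ℕ × ℕ)) :=
  ((Finset.Icc 1 n ×ˢ Finset.Icc 1 (2*n)).powerset).filter (IsTne n)

/-- Number of free points of an even extended Dellac configuration. -/
def frE (n : ℕ) (T : Finset (ℕ × ℕ)) : ℕ :=
  (T.filter (fun p => 2*n + 1 ≤ p.2 + p.1)).card

/-- The (unique) point of `T` in row `r` (junk value if there is none). -/
noncomputable def rowPt (T : Finset (ℕ × ℕ)) (r : ℕ) : ℕ × ℕ :=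
  if h : ∃ p ∈ T, p.2 = r then h.choose else (0, 0)

/-- `p` is the upper of the two points of its column in `T`. -/
def IsUpper (T : Finset (ℕ × ℕ)) (p : ℕ × ℕ) : Prop :=
  ∃ q ∈ T, q.1 = p.1 ∧ q.2 < p.2

/-- One step of the path of Definition 1.2 (even case). -/
noncomputable def stepE (n : ℕ) (T : Finset (ℕ × ℕ)) (p : ℕ × ℕ) : ℕ × ℕ :=
  if p.1 = n then p
  else if IsUpper T p then rowPt T (2*n - p.1) else rowPt T p.1

/-- The path `(p_0, p_1, …)` starting at the point of row `i` (even case). -/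
noncomputable def pathE (n : ℕ) (T : Finset (ℕ × ℕ)) (i k : ℕ) : ℕ × ℕ :=
  (stepE n T)^[k] (rowPt T i)

/-- The set of points of the subsequence `S_T(i)` of strict column records. -/
noncomputable def recSetE (n : ℕ) (T : Finset (ℕ × ℕ)) (i : ℕ) : Set (ℕ × ℕ) :=
  {p | ∃ k, pathE n T i k = p ∧ ∀ k' < k, (pathE n T i k').1 < p.1}

/-- `b(T)`: `B(T) = S_T(n)` has `b(T) + 1` elements. -/
noncomputable def bStat (n : ℕ) (T : Finset (ℕ × ℕ)) : ℕ := (recSetE n T n).ncard - 1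

/-- `r(T)`: `R(T) = S_T(2n)` has `r(T) + 1` elements. -/
noncomputable def rStat (n : ℕ) (T : Finset (ℕ × ℕ)) : ℕ := (recSetE n T (2*n)).ncard - 1

/-- Row of the upper point of column `c` of `T`. -/
noncomputable def upRow (T : Finset (ℕ × ℕ)) (c : ℕ) : ℕ := sSup {i | (c, i) ∈ T}

/-- Row of the lower point of column `c` of `T`. -/
noncomputable def lowRow (T : Finset (ℕ × ℕ)) (c : ℕ) : ℕ := sInf {i | (c, i) ∈ T}

/-- One step of the root sequence `I_T(j,i)`, in a tableau with `R` rows. -/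
noncomputable def rStep (R j : ℕ) (T : Finset (ℕ × ℕ)) (x : ℕ) : ℕ :=
  if (j ≤ x ∧ x ≤ R - j) ∨ x = R then x
  else if R - j + 1 ≤ x ∧ x ≤ R - 1 then upRow T (R - x)
  else lowRow T x

/-- `root_T(j,i)`: the eventual constant value of the sequence `I_T(j,i)`
(junk value `0` if the sequence is not eventually constant). -/
noncomputable def rootVal (R j : ℕ) (T : Finset (ℕ × ℕ)) (i : ℕ) : ℕ :=
  if h : ∃ v, ∃ N, ∀ k ≥ N, (rStep R j T)^[k] i = v then h.choose else 0

/-- The set `G(T)` for an even extended Dellac configuration. -/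
noncomputable def GsetE (n : ℕ) (T : Finset (ℕ × ℕ)) : Set (ℕ × ℕ) :=
  {p | p ∈ T ∧ 2*n + 1 ≤ p.2 + p.1 ∧
    (∃ q ∈ T, q.1 = p.1 ∧ q ≠ p ∧ q ∈ recSetE n T n) ∧ rootVal (2*n) p.1 T p.2 = p.1}

/-- `g(T) = |G(T)|`. -/
noncomputable def gStat (n : ℕ) (T : Finset (ℕ × ℕ)) : ℕ := (GsetE n T).ncard

/-- `max(T) = b(T) + r(T) + g(T)`. -/
noncomputable def maxStat (n : ℕ) (T : Finset (ℕ × ℕ)) : ℕ :=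
  bStat n T + rStat n T + gStat n T

/-! ### Odd extended Dellac configurations -/

/-- `T` is an odd extended Dellac configuration of size `n`. -/
def IsTno (n : ℕ) (T : Finset (ℕ × ℕ)) : Prop :=
  (∀ p ∈ T, 1 ≤ p.1 ∧ p.1 ≤ n ∧ 1 ≤ p.2 ∧ p.2 ≤ 2*n+1 ∧ p.1 ≤ p.2) ∧
  (∀ i : ℕ, (T.filter (fun p => p.2 = i)).card ≤ 1) ∧
  (∀ i ∈ Finset.Icc 1 n, (T.filter (fun p => p.2 = i)).card = 1) ∧
  (∀ j ∈ Finset.Icc 1 n, (T.filter (fun p => p.1 = j)).card = 2)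

/-- The finite set of odd extended Dellac configurations of size `n`. -/
noncomputable def TnoF (n : ℕ) : Finset (Finset (ℕ × ℕ)) :=
  ((Finset.Icc 1 n ×ˢ Finset.Icc 1 (2*n+1)).powerset).filter (IsTno n)

/-- Number of free points of an odd extended Dellac configuration. -/
def frO (n : ℕ) (T : Finset (ℕ × ℕ)) : ℕ :=
  (T.filter (fun p => 2*n + 2 ≤ p.2 + p.1)).card

/-- One step of the path (odd case): if the required row is empty, stay put. -/
noncomputable def stepO (n : ℕ) (T : Finset (ℕ × ℕ)) (p : ℕ × ℕ) : ℕ × ℕ :=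
  if p.1 = n then p
  else
    let r : ℕ := if IsUpper T p then 2*n + 1 - p.1 else p.1
    if ∃ q ∈ T, q.2 = r then rowPt T r else p

/-- The path `(p_0, p_1, …)` starting at the point of row `i` (odd case). -/
noncomputable def pathO (n : ℕ) (T : Finset (ℕ × ℕ)) (i k : ℕ) : ℕ × ℕ :=
  (stepO n T)^[k] (rowPt T i)

/-- The set of points of `V(T) = S_T(2n+1)` (empty if row `2n+1` is empty). -/
noncomputable def Vset (n : ℕ) (T : Finset (ℕ × ℕ)) : Set (ℕ × ℕ) :=
  if ∃ p ∈ T, p.2 = 2*n + 1 then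
    {p | ∃ k, pathO n T (2*n+1) k = p ∧ ∀ k' < k, (pathO n T (2*n+1) k').1 < p.1}
  else ∅

/-- `v(T)`: the number of elements of `V(T)`. -/
noncomputable def vStat (n : ℕ) (T : Finset (ℕ × ℕ)) : ℕ := (Vset n T).ncard

/-- The set `G(T)` for an odd extended Dellac configuration. -/
noncomputable def GsetO (n : ℕ) (T : Finset (ℕ × ℕ)) : Set (ℕ × ℕ) :=
  {p | p ∈ T ∧ 2*n + 2 ≤ p.2 + p.1 ∧
    (∃ q ∈ T, q.1 = p.1 ∧ q ≠ p ∧ q ∈ Vset n T) ∧ rootVal (2*n+1) p.1 T p.2 = p.1}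

/-- `g(T) = |G(T)|` (odd case). -/
noncomputable def gStatO (n : ℕ) (T : Finset (ℕ × ℕ)) : ℕ := (GsetO n T).ncard

/-! ### Dellac configurations and symmetric Dellac configurations -/

/-- `D` is a Dellac configuration of size `N`. -/
def IsDC (N : ℕ) (D : Finset (ℕ × ℕ)) : Prop :=
  (∀ p ∈ D, 1 ≤ p.1 ∧ p.1 ≤ N ∧ 1 ≤ p.2 ∧ p.2 ≤ 2*N ∧ p.1 ≤ p.2 ∧ p.2 ≤ N + p.1) ∧
  (∀ i ∈ Finset.Icc 1 (2*N), (D.filter (fun p => p.2 = i)).card = 1) ∧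
  (∀ j ∈ Finset.Icc 1 N, (D.filter (fun p => p.1 = j)).card = 2)

/-- `D` is a symmetric Dellac configuration of size `N`. -/
def IsSDC (N : ℕ) (D : Finset (ℕ × ℕ)) : Prop :=
  IsDC N D ∧ ∀ p ∈ D, (N + 1 - p.1, 2*N + 1 - p.2) ∈ D

/-- The finite set of symmetric Dellac configurations of size `N`. -/
noncomputable def SDCF (N : ℕ) : Finset (Finset (ℕ × ℕ)) :=
  ((Finset.Icc 1 N ×ˢ Finset.Icc 1 (2*N)).powerset).filter (IsSDC N)

/-! ### Surjective pistols -/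

/-- `p` encodes a surjective pistol of size `n`: position `k` stands for `k+1 ∈ {1,…,2n}`
and value `p k` stands for `(p k) + 1 ∈ {2,4,…,2n}`. -/
def IsSP (n : ℕ) (p : Fin (2*n) → Fin (2*n)) : Prop :=
  (∀ k, Even ((p k : ℕ) + 1) ∧ (k : ℕ) ≤ (p k : ℕ)) ∧
  (∀ m : Fin (2*n), Even ((m : ℕ) + 1) → ∃ k, p k = m)

/-- The finite set of surjective pistols of size `n`. -/
noncomputable def SPF (n : ℕ) : Finset (Fin (2*n) → Fin (2*n)) :=
  Finset.univ.filter (IsSP n)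

/-- `max(f)`: the number of `j ∈ {1,…,2n-2}` with `f(j) = 2n`. -/
noncomputable def maxP (n : ℕ) (p : Fin (2*n) → Fin (2*n)) : ℕ :=
  (Finset.univ.filter (fun k : Fin (2*n) => (k : ℕ) + 1 ≤ 2*n - 2 ∧ (p k : ℕ) + 1 = 2*n)).card

/-- `fd(f)`: the number of doubled fixed points of `f`. -/
noncomputable def fdP (n : ℕ) (p : Fin (2*n) → Fin (2*n)) : ℕ :=
  (Finset.univ.filter (fun k : Fin (2*n) =>
    (k : ℕ) + 1 ≤ 2*n - 2 ∧ (p k : ℕ) = (k : ℕ) ∧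
      ∃ k' : Fin (2*n), (k' : ℕ) < (k : ℕ) ∧ p k' = p k)).card

end SymDellac
/-! ### More constructions -/

namespace SymDellac

/-- `e_{n,k} = Σ_{T ∈ T_n^e, max(T) = k} 2^{fr(T) - 1 - k}`. -/
noncomputable def eStat (n k : ℕ) : ℕ :=
  ∑ T ∈ (TneF n).filter (fun T => maxStat n T = k), 2 ^ (frE n T - 1 - k)

/-- The configuration `T_{n,max}` with points `(j,j)` and `(j, 2n+1-j)` for `j ∈ [n]`. -/
def Tmax (n : ℕ) : Finset (ℕ × ℕ) :=
  (Finset.Icc 1 n).image (fun j => (j, j)) ∪ (Finset.Icc 1 n).image (fun j => (j, 2*n + 1 - j))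

/-- The index of the (unique) empty row of an odd extended Dellac configuration. -/
noncomputable def emptyRowIdx (n : ℕ) (T : Finset (ℕ × ℕ)) : ℕ :=
  sInf {i | 1 ≤ i ∧ i ≤ 2*n + 1 ∧ ∀ p ∈ T, p.2 ≠ i}

/-- The map `φ : T_n^o → T_n^e` deleting the empty row. -/
noncomputable def phi (n : ℕ) (T : Finset (ℕ × ℕ)) : Finset (ℕ × ℕ) :=
  T.image (fun p => if emptyRowIdx n T < p.2 then (p.1, p.2 - 1) else p)

/-- `Omax(T)`: the set of all points of `B(T)`, `R(T)` and `G(T)`. -/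
noncomputable def OmaxE (n : ℕ) (T : Finset (ℕ × ℕ)) : Set (ℕ × ℕ) :=
  recSetE n T n ∪ recSetE n T (2*n) ∪ GsetE n T

/-- Insertion of a point in the box `(j, r)` of a tableau `U` with `R` rows:
add the point `(j, i₀)` where `i₀` is the (unique) row with no point of `U`
in columns `1,…,j-1` whose root equals `r`. -/
noncomputable def insertPt (R j r : ℕ) (U : Finset (ℕ × ℕ)) : Finset (ℕ × ℕ) :=
  if h : ∃ i0, j ≤ i0 ∧ i0 ≤ R ∧ (∀ p ∈ U, p.2 = i0 → j ≤ p.1) ∧ rootVal R j U i0 = r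
  then insert (j, h.choose) U else U

/-- One step (column `j`) of the construction of `P(T)`. -/
noncomputable def Pstep (n : ℕ) (T : Finset (ℕ × ℕ)) (U : Finset (ℕ × ℕ)) (j : ℕ) :
    Finset (ℕ × ℕ) :=
  let U1 := if ∃ p ∈ T, p.1 = j ∧ p ∈ recSetE n T n ∪ recSetE n T (2*n)
    then insertPt (2*n - 1) j (2*n - 1) U else U
  if ∃ p ∈ T, p.1 = j ∧ p ∈ GsetE n T then insertPt (2*n - 1) j j U1 else U1

/-- The map `P : T_n^e → T_{n-1}^o`. -/
noncomputable def Pmap (n : ℕ) (T : Finset (ℕ × ℕ)) : Finset (ℕ × ℕ) :=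
  (List.range' 1 (n-1)).foldl (Pstep n T)
    ((T.filter (fun p => p ∉ OmaxE n T)).image
      (fun p => (p.1, if p.2 < n then p.2 else p.2 - 1)))

end SymDellac

namespace SymDellac

section

/-! ### Iterating a partially injective map -/

theorem iterate_cancel {α : Type*} {A : Set α} {f : α → α} (hinj : Set.InjOn f A) {x y : α} :
    ∀ a : ℕ, (∀ i < a, f^[i] x ∈ A) → (∀ i < a, f^[i] y ∈ A) → f^[a] x = f^[a] y → x = y
  | 0, _, _, h => h
  | a + 1, hx, hy, h => by
    rw [Function.iterate_succ_apply', Function.iterate_succ_apply'] at h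
    exact iterate_cancel hinj a (fun i hi => hx i (by omega)) (fun i hi => hy i (by omega))
      (hinj (hx a (by omega)) (hy a (by omega)) h)

/-- A map injective on `N \ Ω` leads every element of `N` outside its range into `Ω`. -/
theorem exists_first_iterate_mem {α : Type*} {N : Finset α} {Ω : Set α} {f : α → α}
    (hmaps : ∀ x ∈ N, x ∉ Ω → f x ∈ N) (hinj : Set.InjOn f {x | x ∈ N ∧ x ∉ Ω})
    {x : α} (hx : x ∈ N) (hx' : ∀ y ∈ N, y ∉ Ω → f y ≠ x) :
    ∃ k, f^[k] x ∈ Ω ∧ f^[k] x ∈ N ∧ ∀ i < k, f^[i] x ∈ N ∧ f^[i] x ∉ Ω := by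
  have key : ∃ k, f^[k] x ∈ Ω := by
    by_contra! hcon
    have hN : ∀ k, f^[k] x ∈ N := by
      intro k
      induction k with
      | zero => exact hx
      | succ k ih => rw [Function.iterate_succ_apply']; exact hmaps _ ih (hcon k)
    have hni : ¬ Function.Injective (fun k : ℕ => (⟨f^[k] x, hN k⟩ : N)) :=
      not_injective_infinite_finite _
    rw [Function.Injective] at hni
    push Not at hni
    obtain ⟨a, b, hab, hne⟩ := hni
    have hab : f^[a] x = f^[b] x := by simpa using hab
    have main : ∀ a b : ℕ, a < b → f^[a] x ≠ f^[b] x := by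
      intro a b hlt hab
      obtain ⟨d, rfl⟩ := Nat.exists_eq_add_of_lt hlt
      rw [show a + d + 1 = a + (d + 1) by ring, Function.iterate_add_apply] at hab
      have := iterate_cancel hinj a (fun i _ => ⟨hN i, hcon i⟩)
        (fun i _ => by rw [← Function.iterate_add_apply]; exact ⟨hN _, hcon _⟩) hab
      rw [Function.iterate_succ_apply'] at this
      exact hx' _ (hN d) (hcon d) this.symm
    rcases lt_or_gt_of_ne hne with h | h
    · exact main _ _ h hab
    · exact main _ _ h hab.symm
  have hlt : ∀ i < Nat.find key, f^[i] x ∉ Ω := fun i hi => Nat.find_min key hi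
  have hN : ∀ i ≤ Nat.find key, f^[i] x ∈ N := by
    intro i
    induction i with
    | zero => intro _; exact hx
    | succ i ih =>
      intro hi
      rw [Function.iterate_succ_apply']
      exact hmaps _ (ih (by omega)) (hlt i (by omega))
  exact ⟨Nat.find key, Nat.find_spec key, hN _ le_rfl,
    fun i hi => ⟨hN i hi.le, hlt i hi⟩⟩

theorem first_iterate_injective {α : Type*} {A : Set α} {f : α → α} (hinj : Set.InjOn f A)
    {x y : α} (hx : ∀ u ∈ A, f u ≠ x) (hy : ∀ u ∈ A, f u ≠ y) {a b : ℕ}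
    (ha : ∀ i < a, f^[i] x ∈ A) (hb : ∀ i < b, f^[i] y ∈ A) (h : f^[a] x = f^[b] y) : x = y := by
  wlog hab : a ≤ b generalizing x y a b
  · exact (this hy hx hb ha h.symm (by omega)).symm
  obtain ⟨d, rfl⟩ := Nat.exists_eq_add_of_le hab
  rw [Function.iterate_add_apply] at h
  have h2 := iterate_cancel hinj a ha
    (fun i hi => by rw [← Function.iterate_add_apply]; exact hb _ (by omega)) h
  cases d with
  | zero => exact h2
  | succ d =>
    rw [Function.iterate_succ_apply'] at h2
    exact absurd h2.symm (hx _ (hb d (by omega)))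

/-! ### Partial configurations -/

/-- `U` consists of the first `k` columns of an even extended Dellac configuration of size `n`. -/
structure IsPartial (n k : ℕ) (U : Finset (ℕ × ℕ)) : Prop where
  bounds : ∀ p ∈ U, 1 ≤ p.1 ∧ p.1 ≤ k ∧ p.2 ≤ 2 * n ∧ p.1 ≤ p.2
  row_inj : ∀ p ∈ U, ∀ q ∈ U, p.2 = q.2 → p = q
  card_col : ∀ j, 1 ≤ j → j ≤ k → (U.filter (fun p => p.1 = j)).card = 2
  filled : ∀ i, 1 ≤ i → i ≤ k → i ∈ U.image Prod.snd

/-- The rows that are possible roots at column `j`. -/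
def rootSet (n j : ℕ) : Finset ℕ := insert (2 * n) (Finset.Icc j (2 * n - j))

/-- The rows of `[1, 2n]` not met by `U`. -/
noncomputable def emptyRows (n : ℕ) (U : Finset (ℕ × ℕ)) : Finset ℕ :=
  Finset.Icc 1 (2 * n) \ U.image Prod.snd

variable {n k : ℕ} {U T : Finset (ℕ × ℕ)}

theorem mem_rootSet {j x : ℕ} : x ∈ rootSet n j ↔ x = 2 * n ∨ (j ≤ x ∧ x ≤ 2 * n - j) := by
  simp [rootSet]

theorem IsPartial.column_spec (hU : IsPartial n k U) {c : ℕ} (h1 : 1 ≤ c) (hk : c ≤ k) :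
    lowRow U c < upRow U c ∧ (c, lowRow U c) ∈ U ∧ (c, upRow U c) ∈ U ∧
      ∀ i, (c, i) ∈ U → i = lowRow U c ∨ i = upRow U c := by
  obtain ⟨p, q, hpq, hS⟩ := Finset.card_eq_two.1 (hU.card_col c h1 hk)
  have hmem : ∀ r, r ∈ U ∧ r.1 = c ↔ r = p ∨ r = q := by
    intro r
    have := congrArg (r ∈ ·) hS
    simpa using this
  obtain ⟨a, b, hab, hrow⟩ : ∃ a b, a < b ∧ ∀ i, (c, i) ∈ U ↔ i = a ∨ i = b := by
    obtain ⟨hp, hp1⟩ := (hmem p).2 (Or.inl rfl)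
    obtain ⟨hq, hq1⟩ := (hmem q).2 (Or.inr rfl)
    obtain ⟨p1, p2⟩ := p
    obtain ⟨q1, q2⟩ := q
    simp only at hp1 hq1
    subst hp1
    subst hq1
    have hne : p2 ≠ q2 := fun h => hpq (by rw [h])
    rcases lt_or_gt_of_ne hne with h | h
    · exact ⟨p2, q2, h, fun i => by simpa using hmem (q1, i)⟩
    · exact ⟨q2, p2, h, fun i => by simpa [or_comm] using hmem (q1, i)⟩
  have hset : {i | (c, i) ∈ U} = {a, b} := by
    ext i
    simp [hrow]
  have hl : lowRow U c = a := by
    rw [lowRow, hset, csInf_pair]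
    exact inf_eq_left.2 hab.le
  have hu : upRow U c = b := by
    rw [upRow, hset, csSup_pair]
    exact sup_eq_right.2 hab.le
  rw [hl, hu]
  exact ⟨hab, (hrow a).2 (Or.inl rfl), (hrow b).2 (Or.inr rfl), fun i hi => (hrow i).1 hi⟩

theorem rStep_of_mem {j x : ℕ} (hx : x ∈ rootSet n j) : rStep (2 * n) j U x = x := by
  rw [mem_rootSet] at hx
  rw [rStep, if_pos (by tauto)]

theorem rStep_low {j x : ℕ} (hj : j ≤ n) (hx : x < j) : rStep (2 * n) j U x = lowRow U x := by
  rw [rStep, if_neg (by omega), if_neg (by omega)]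

theorem rStep_up {j x : ℕ} (hj : j ≤ n) (hx : x < j) (hx1 : 1 ≤ x) :
    rStep (2 * n) j U (2 * n - x) = upRow U x := by
  rw [rStep, if_neg (by omega), if_pos (by omega), show 2 * n - (2 * n - x) = x by omega]

theorem not_mem_rootSet {j x : ℕ} (hj : j ≤ n) (hx : x ∈ Finset.Icc 1 (2 * n)) :
    x ∉ rootSet n j ↔ x < j ∨ ∃ y, 1 ≤ y ∧ y < j ∧ x = 2 * n - y := by
  rw [mem_rootSet]
  rw [Finset.mem_Icc] at hx
  constructor
  · intro h
    by_cases hxj : x < j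
    · exact Or.inl hxj
    · exact Or.inr ⟨2 * n - x, by omega, by omega, by omega⟩
  · rintro (h | ⟨y, h1, h2, h3⟩) <;> omega

/-- A root step from a row that is not a root leads to a point of the corresponding column. -/
theorem IsPartial.rStep_spec (hU : IsPartial n k U) {j x : ℕ} (hj : j ≤ n) (hjk : j ≤ k + 1)
    (hx : x ∈ Finset.Icc 1 (2 * n)) (hx' : x ∉ rootSet n j) :
    (x < j ∧ rStep (2 * n) j U x = lowRow U x ∧ (x, rStep (2 * n) j U x) ∈ U) ∨
    (∃ y, 1 ≤ y ∧ y < j ∧ x = 2 * n - y ∧ rStep (2 * n) j U x = upRow U y ∧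
      (y, rStep (2 * n) j U x) ∈ U) := by
  have hx1 := (Finset.mem_Icc.1 hx).1
  rcases (not_mem_rootSet hj hx).1 hx' with h | ⟨y, h1, h2, rfl⟩
  · left
    rw [rStep_low hj h]
    exact ⟨h, rfl, (hU.column_spec hx1 (by omega)).2.1⟩
  · right
    rw [rStep_up hj h2 h1]
    exact ⟨y, h1, h2, rfl, rfl, (hU.column_spec h1 (by omega)).2.2.1⟩

theorem IsPartial.rStep_maps (hU : IsPartial n k U) {j x : ℕ} (hj : j ≤ n) (hjk : j ≤ k + 1)
    (hx : x ∈ Finset.Icc 1 (2 * n)) (hx' : x ∉ rootSet n j) :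
    rStep (2 * n) j U x ∈ Finset.Icc 1 (2 * n) ∧ ∃ c < j, (c, rStep (2 * n) j U x) ∈ U := by
  obtain ⟨h1, _, h3⟩ | ⟨y, _, h1, _, _, h3⟩ := hU.rStep_spec hj hjk hx hx'
  all_goals
    have := hU.bounds _ h3
    simp only at this
    exact ⟨Finset.mem_Icc.2 (by omega), _, h1, h3⟩

theorem IsPartial.rStep_injOn (hU : IsPartial n k U) {j : ℕ} (hj : j ≤ n) (hjk : j ≤ k + 1) :
    Set.InjOn (rStep (2 * n) j U)
      {x | x ∈ Finset.Icc 1 (2 * n) ∧ x ∉ (rootSet n j : Set ℕ)} := by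
  rintro x ⟨hx, hx'⟩ x' ⟨hz, hz'⟩ hxx
  have hx1 := Finset.mem_Icc.1 hx
  have hz1 := Finset.mem_Icc.1 hz
  obtain ⟨h1, h2, h3⟩ | ⟨y, h0, h1, h4, h2, h3⟩ := hU.rStep_spec hj hjk hx (by simpa using hx') <;>
  obtain ⟨g1, g2, g3⟩ | ⟨y', g0, g1, g4, g2, g3⟩ := hU.rStep_spec hj hjk hz (by simpa using hz') <;>
  have he := hU.row_inj _ h3 _ g3 hxx <;> rw [Prod.mk.injEq] at he <;> obtain ⟨he, -⟩ := he
  · exact he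
  · have := (hU.column_spec hx1.1 (by omega)).1
    rw [h2, g2, ← he] at hxx
    omega
  · have := (hU.column_spec h0 (by omega)).1
    rw [h2, g2, ← he] at hxx
    omega
  · omega

theorem IsPartial.exists_rStep_eq (hU : IsPartial n k U) {j : ℕ} (hj : j ≤ n)
    {p : ℕ × ℕ} (hp : p ∈ U) (hpj : p.1 < j) :
    ∃ x ∈ Finset.Icc 1 (2 * n), x ∉ rootSet n j ∧ rStep (2 * n) j U x = p.2 := by
  have hb := hU.bounds _ hp
  obtain h | h := (hU.column_spec hb.1 hb.2.1).2.2.2 p.2 hp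
  · have hI : p.1 ∈ Finset.Icc 1 (2 * n) := Finset.mem_Icc.2 (by omega)
    exact ⟨p.1, hI, (not_mem_rootSet hj hI).2 (Or.inl hpj), by rw [rStep_low hj hpj, h]⟩
  · have hI : 2 * n - p.1 ∈ Finset.Icc 1 (2 * n) := Finset.mem_Icc.2 (by omega)
    exact ⟨2 * n - p.1, hI, (not_mem_rootSet hj hI).2 (Or.inr ⟨p.1, hb.1, hpj, rfl⟩),
      by rw [rStep_up hj hpj hb.1, h]⟩

theorem rootVal_eq {j i r m : ℕ} (hr : r ∈ rootSet n j) (h : (rStep (2 * n) j U)^[m] i = r) :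
    rootVal (2 * n) j U i = r := by
  have hall : ∀ q ≥ m, (rStep (2 * n) j U)^[q] i = r := by
    intro q hq
    obtain ⟨d, rfl⟩ := Nat.exists_eq_add_of_le hq
    rw [add_comm, Function.iterate_add_apply, h]
    exact Function.iterate_fixed (rStep_of_mem hr) d
  have hex : ∃ v, ∃ N, ∀ q ≥ N, (rStep (2 * n) j U)^[q] i = v := ⟨r, m, hall⟩
  rw [rootVal, dif_pos hex]
  obtain ⟨N, hN⟩ := hex.choose_spec
  rw [← hN (max N m) (le_max_left _ _), hall _ (le_max_right _ _)]

theorem rootVal_of_mem {j i : ℕ} (hi : i ∈ rootSet n j) : rootVal (2 * n) j U i = i :=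
  rootVal_eq (m := 0) hi rfl

/-- From a row not met by the columns before `j`, the root sequence first reaches a root
after finitely many steps. -/
theorem IsPartial.rootVal_spec (hU : IsPartial n k U) {j i : ℕ} (hj : j ≤ n) (hjk : j ≤ k + 1)
    (hi : i ∈ Finset.Icc 1 (2 * n)) (hi' : ∀ p ∈ U, p.2 = i → j ≤ p.1) :
    ∃ m, (rStep (2 * n) j U)^[m] i = rootVal (2 * n) j U i ∧
      rootVal (2 * n) j U i ∈ rootSet n j ∧
      ∀ a < m, (rStep (2 * n) j U)^[a] i ∈ Finset.Icc 1 (2 * n) ∧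
        (rStep (2 * n) j U)^[a] i ∉ (rootSet n j : Set ℕ) := by
  obtain ⟨m, h1, -, h3⟩ := exists_first_iterate_mem (N := Finset.Icc 1 (2 * n))
    (Ω := (rootSet n j : Set ℕ)) (f := rStep (2 * n) j U)
    (fun x hx hx' => (hU.rStep_maps hj hjk hx (by simpa using hx')).1)
    (hU.rStep_injOn hj hjk) hi (by
      intro y hy hy' he
      obtain ⟨-, c, hc, hm⟩ := hU.rStep_maps hj hjk hy (by simpa using hy')
      have := hi' _ hm he
      simp only at this
      omega)
  have h1' : (rStep (2 * n) j U)^[m] i ∈ rootSet n j := by simpa using h1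
  have he := rootVal_eq h1' rfl
  exact ⟨m, he.symm, he ▸ h1', h3⟩

theorem IsPartial.rootVal_injOn (hU : IsPartial n k U) {j i i' : ℕ} (hj : j ≤ n)
    (hjk : j ≤ k + 1)
    (hi : i ∈ Finset.Icc 1 (2 * n)) (hi' : ∀ p ∈ U, p.2 = i → j ≤ p.1)
    (hz : i' ∈ Finset.Icc 1 (2 * n)) (hz' : ∀ p ∈ U, p.2 = i' → j ≤ p.1)
    (h : rootVal (2 * n) j U i = rootVal (2 * n) j U i') : i = i' := by
  obtain ⟨a, ha, -, ha'⟩ := hU.rootVal_spec hj hjk hi hi'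
  obtain ⟨b, hb, -, hb'⟩ := hU.rootVal_spec hj hjk hz hz'
  refine first_iterate_injective (hU.rStep_injOn hj hjk) ?_ ?_ ha' hb' (by rw [ha, hb, h])
  all_goals
    rintro u ⟨hu, hu'⟩ he
    obtain ⟨-, c, hc, hm⟩ := hU.rStep_maps hj hjk hu (by simpa using hu')
  · have := hi' _ hm he
    simp only at this
    omega
  · have := hz' _ hm he
    simp only at this
    omega

/-- A row which is not its own root has a nonempty row, or the top row, as root. -/
theorem IsPartial.rootVal_mem_of_ne (hU : IsPartial n k U) {j i : ℕ} (hj : j ≤ n)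
    (hjk : j ≤ k + 1)
    (hi : i ∈ Finset.Icc 1 (2 * n)) (hi' : ∀ p ∈ U, p.2 = i → j ≤ p.1)
    (h : i ∉ rootSet n j) : rootVal (2 * n) j U i ∈ U.image Prod.snd := by
  obtain ⟨m, hm, hr, hm'⟩ := hU.rootVal_spec hj hjk hi hi'
  cases m with
  | zero => exact absurd (by simpa [← hm] using hr) h
  | succ m =>
    obtain ⟨h1, h2⟩ := hm' m (by omega)
    obtain ⟨-, c, -, hc⟩ := hU.rStep_maps hj hjk h1 (by simpa using h2)
    rw [← hm, Function.iterate_succ_apply']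
    exact Finset.mem_image.2 ⟨_, hc, rfl⟩

theorem rStep_congr {R j : ℕ} {V : Finset (ℕ × ℕ)}
    (h : ∀ c, (c < j ∨ R < c) → ∀ i, (c, i) ∈ U ↔ (c, i) ∈ V) : rStep R j U = rStep R j V := by
  funext x
  rw [rStep, rStep]
  split_ifs with h1 h2
  · rfl
  · rw [upRow, upRow]
    simp only [h (R - x) (by omega)]
  · rw [lowRow, lowRow]
    simp only [h x (by omega)]

theorem rootVal_congr {R j : ℕ} {V : Finset (ℕ × ℕ)}
    (h : ∀ c, (c < j ∨ R < c) → ∀ i, (c, i) ∈ U ↔ (c, i) ∈ V) :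
    rootVal R j U = rootVal R j V := by
  funext i
  rw [rootVal, rootVal]
  simp only [rStep_congr h]

/-! ### Records of the path and roots -/

theorem IsPartial.card_image_snd (hU : IsPartial n k U) : (U.image Prod.snd).card = U.card :=
  Finset.card_image_of_injOn fun p hp q hq h => hU.row_inj p hp q hq h

theorem IsPartial.card_filter (hU : IsPartial n k U) (Q : ℕ × ℕ → Prop) [DecidablePred Q]
    {S : Finset ℕ}
    (hS : ∀ p ∈ U, Q p → p.1 ∈ S) :
    (U.filter Q).card =
      ∑ j ∈ S, (((U.filter (fun p => p.1 = j)).image Prod.snd).filter (fun i => Q (j, i))).card := by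
  rw [Finset.card_eq_sum_card_fiberwise (f := Prod.fst) (t := S)
    (fun p hp => by
      have := Finset.mem_filter.1 (Finset.mem_coe.1 hp)
      exact hS p this.1 this.2)]
  refine Finset.sum_congr rfl fun j _ => ?_
  rw [Finset.filter_filter, Finset.filter_image, Finset.filter_filter, Finset.card_image_of_injOn]
  · congr 1
    ext p
    simp only [Finset.mem_filter]
    constructor
    · rintro ⟨h1, h2, h3⟩
      exact ⟨h1, h3, by rw [← h3]; exact h2⟩
    · rintro ⟨h1, h2, h3⟩
      exact ⟨h1, by rw [← h2] at h3; exact h3, h2⟩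
  · intro p hp q hq h
    exact hU.row_inj p (Finset.mem_filter.1 hp).1 q (Finset.mem_filter.1 hq).1 h

theorem IsPartial.card_eq (hU : IsPartial n k U) : U.card = 2 * k := by
  have h := hU.card_filter (fun _ => True) (S := Finset.Icc 1 k)
    (fun p hp _ => Finset.mem_Icc.2 ⟨(hU.bounds p hp).1, (hU.bounds p hp).2.1⟩)
  rw [Finset.filter_true] at h
  rw [h, Finset.sum_congr rfl (g := fun _ => 2), Finset.sum_const, Nat.card_Icc]
  · simp [mul_comm]
  · intro j hj
    rw [Finset.mem_Icc] at hj
    rw [Finset.filter_true, Finset.card_image_of_injOn, hU.card_col j hj.1 hj.2]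
    intro p hp q hq h
    exact hU.row_inj p (Finset.mem_filter.1 hp).1 q (Finset.mem_filter.1 hq).1 h

theorem IsPartial.image_snd_subset (hU : IsPartial n k U) :
    U.image Prod.snd ⊆ Finset.Icc 1 (2 * n) := by
  intro i hi
  obtain ⟨p, hp, rfl⟩ := Finset.mem_image.1 hi
  have := hU.bounds p hp
  exact Finset.mem_Icc.2 (by omega)

theorem IsPartial.card_emptyRows (hU : IsPartial n k U) :
    (emptyRows n U).card = 2 * n - 2 * k := by
  rw [emptyRows, Finset.card_sdiff_of_subset hU.image_snd_subset, hU.card_image_snd, hU.card_eq]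
  simp

theorem isTne_iff {T : Finset (ℕ × ℕ)} : IsTne n T ↔ IsPartial n n T := by
  constructor
  · rintro ⟨h1, h2, h3⟩
    have hinj : ∀ p ∈ T, ∀ q ∈ T, p.2 = q.2 → p = q := by
      intro p hp q hq h
      have hb := h1 p hp
      have := Finset.card_le_one.1 (h2 p.2 (Finset.mem_Icc.2 ⟨hb.2.2.1, hb.2.2.2.1⟩)).le
      exact this p (by simp [hp]) q (by simp [hq, h])
    refine ⟨fun p hp => ?_, hinj, fun j hj hj' => h3 j (Finset.mem_Icc.2 ⟨hj, hj'⟩), ?_⟩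
    · have := h1 p hp
      tauto
    · intro i hi hi'
      obtain ⟨p, hp⟩ := Finset.card_pos.1 (by rw [h2 i (Finset.mem_Icc.2 (by omega))]; omega)
      rw [Finset.mem_filter] at hp
      exact Finset.mem_image.2 ⟨p, hp⟩
  · intro h
    refine ⟨fun p hp => ?_, fun i hi => ?_, fun j hj => ?_⟩
    · have := h.bounds p hp
      omega
    · have he : T.image Prod.snd = Finset.Icc 1 (2 * n) := by
        refine Finset.eq_of_subset_of_card_le h.image_snd_subset ?_
        rw [h.card_image_snd, h.card_eq]
        simp
      rw [← he] at hi
      obtain ⟨p, hp, rfl⟩ := Finset.mem_image.1 hi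
      refine Finset.card_eq_one.2 ⟨p, ?_⟩
      ext q
      simp only [Finset.mem_filter, Finset.mem_singleton]
      constructor
      · rintro ⟨hq, hqp⟩
        exact h.row_inj q hq p hp hqp
      · rintro rfl
        exact ⟨hp, rfl⟩
    · rw [Finset.mem_Icc] at hj
      exact h.card_col j hj.1 hj.2

theorem IsPartial.rowPt_eq (hU : IsPartial n k U) {p : ℕ × ℕ} (hp : p ∈ U) : rowPt U p.2 = p := by
  have hex : ∃ q ∈ U, q.2 = p.2 := ⟨p, hp, rfl⟩
  rw [rowPt, dif_pos hex]
  exact hU.row_inj _ hex.choose_spec.1 _ hp hex.choose_spec.2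

theorem IsPartial.image_snd_eq (hT : IsPartial n n T) :
    T.image Prod.snd = Finset.Icc 1 (2 * n) := by
  refine Finset.eq_of_subset_of_card_le hT.image_snd_subset ?_
  rw [hT.card_image_snd, hT.card_eq]
  simp

theorem IsPartial.rowPt_mem (hT : IsPartial n n T) {i : ℕ} (hi : i ∈ Finset.Icc 1 (2 * n)) :
    rowPt T i ∈ T ∧ (rowPt T i).2 = i := by
  rw [← hT.image_snd_eq] at hi
  obtain ⟨p, hp, rfl⟩ := Finset.mem_image.1 hi
  rw [hT.rowPt_eq hp]
  exact ⟨hp, rfl⟩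

/-- The path inverts the root step. -/
theorem IsPartial.stepE_rowPt_rStep (hT : IsPartial n n T) {j x : ℕ} (hj : j ≤ n)
    (hx : x ∈ Finset.Icc 1 (2 * n)) (hx' : x ∉ rootSet n j) :
    (rowPt T (rStep (2 * n) j T x)).1 < j ∧
      stepE n T (rowPt T (rStep (2 * n) j T x)) = rowPt T x := by
  have hx1 := Finset.mem_Icc.1 hx
  obtain ⟨h1, h2, h3⟩ | ⟨y, h0, h1, rfl, h2, h3⟩ := hT.rStep_spec hj (by omega) hx hx'
  · have hc := hT.column_spec (c := x) hx1.1 (by omega)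
    rw [hT.rowPt_eq h3]
    refine ⟨h1, ?_⟩
    have hup : ¬ IsUpper T (x, rStep (2 * n) j T x) := by
      rintro ⟨⟨q1, q2⟩, hq, rfl, hlt⟩
      have h4 : q2 = lowRow T q1 ∨ q2 = upRow T q1 := hc.2.2.2 q2 hq
      have h5 : lowRow T q1 < upRow T q1 := hc.1
      simp only [h2] at hlt
      omega
    rw [stepE, if_neg (by simp only; omega), if_neg hup]
  · have hc := hT.column_spec h0 (by omega)
    rw [hT.rowPt_eq h3]
    refine ⟨h1, ?_⟩
    have hup : IsUpper T (y, rStep (2 * n) j T (2 * n - y)) :=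
      ⟨_, hc.2.1, rfl, by simp only [h2]; exact hc.1⟩
    rw [stepE, if_neg (by simp only; omega), if_pos hup]

theorem pathE_succ (i m : ℕ) : pathE n T i (m + 1) = stepE n T (pathE n T i m) := by
  rw [pathE, pathE, Function.iterate_succ_apply']

/-- Points are records of the path from a root row exactly if their row has that root. -/
theorem IsPartial.mem_recSetE (hT : IsPartial n n T) {s : ℕ} (hs : s ∈ Finset.Icc 1 (2 * n))
    (hs' : ∀ j ≤ n, s ∈ rootSet n j) {p : ℕ × ℕ} :
    p ∈ recSetE n T s ↔ p ∈ T ∧ rootVal (2 * n) p.1 T p.2 = s := by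
  constructor
  · rintro ⟨m, hm, hlt⟩
    have key : ∀ m, (∀ a < m, (pathE n T s a).1 < p.1) → (p.1 ≤ n) →
        ∃ x ∈ Finset.Icc 1 (2 * n), rowPt T x = pathE n T s m ∧
          (rStep (2 * n) p.1 T)^[m] x = s := by
      intro m
      induction m with
      | zero => exact fun _ _ => ⟨s, hs, rfl, rfl⟩
      | succ m ih =>
        intro hlt hpn
        obtain ⟨x, hx, hx1, hx2⟩ := ih (fun a ha => hlt a (by omega)) hpn
        obtain ⟨hr, hr2⟩ := hT.rowPt_mem hx
        obtain ⟨x', hx', hx'', he⟩ := hT.exists_rStep_eq hpn hr (by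
          rw [hx1]; exact hlt m (by omega))
        rw [hr2] at he
        refine ⟨x', hx', ?_, by rw [Function.iterate_succ_apply, he, hx2]⟩
        rw [pathE_succ, ← hx1, ← he, (hT.stepE_rowPt_rStep hpn hx' hx'').2]
    have hmem : ∀ m, pathE n T s m ∈ T := by
      intro m
      induction m with
      | zero => exact (hT.rowPt_mem hs).1
      | succ m ih =>
        have hb := hT.bounds _ ih
        rw [pathE_succ, stepE]
        split_ifs with h1 h2
        · exact ih
        · exact (hT.rowPt_mem (Finset.mem_Icc.2 (by omega))).1
        · exact (hT.rowPt_mem (Finset.mem_Icc.2 (by omega))).1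
    have hp : p ∈ T := hm ▸ hmem m
    have hpn := (hT.bounds p hp).2.1
    obtain ⟨x, hx, hx1, hx2⟩ := key m hlt hpn
    rw [hm] at hx1
    have : x = p.2 := by rw [← hx1, (hT.rowPt_mem hx).2]
    exact ⟨hp, rootVal_eq (hs' _ hpn) (this ▸ hx2)⟩
  · rintro ⟨hp, hr⟩
    have hb := hT.bounds p hp
    obtain ⟨m, hm, -, hlt⟩ := hT.rootVal_spec (j := p.1) (i := p.2) hb.2.1 (by omega)
      (Finset.mem_Icc.2 (by omega)) (fun q hq h => by rw [hT.row_inj q hq p hp h])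
    rw [hr] at hm
    have key : ∀ a ≤ m, pathE n T s a = rowPt T ((rStep (2 * n) p.1 T)^[m - a] p.2) := by
      intro a
      induction a with
      | zero => intro _; rw [Nat.sub_zero, hm]; rfl
      | succ a ih =>
        intro ha
        obtain ⟨h1, h2⟩ := hlt (m - (a + 1)) (by omega)
        rw [pathE_succ, ih (by omega), show m - a = m - (a + 1) + 1 by omega,
          Function.iterate_succ_apply', (hT.stepE_rowPt_rStep hb.2.1 h1 (by simpa using h2)).2]
    refine ⟨m, ?_, fun a ha => ?_⟩
    · rw [key m le_rfl, Nat.sub_self, Function.iterate_zero_apply, hT.rowPt_eq hp]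
    · obtain ⟨h1, h2⟩ := hlt (m - (a + 1)) (by omega)
      rw [key a ha.le, show m - a = m - (a + 1) + 1 by omega, Function.iterate_succ_apply']
      exact (hT.stepE_rowPt_rStep hb.2.1 h1 (by simpa using h2)).1

/-! ### The statistics column by column -/

/-- The set of rows of the points of `U` in column `j`. -/
noncomputable def columnRows (U : Finset (ℕ × ℕ)) (j : ℕ) : Finset ℕ :=
  (U.filter (fun p => p.1 = j)).image Prod.snd

/-- The contribution to `max` of a column `j` with set of rows `s`, the roots being given by `ρ`. -/
noncomputable def columnMax (n j : ℕ) (s : Finset ℕ) (ρ : ℕ → ℕ) : ℕ :=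
  (s.filter (fun i => ρ i = n)).card + (s.filter (fun i => ρ i = 2 * n)).card +
    (s.filter (fun i => 2 * n + 1 ≤ i + j ∧ ρ i = j ∧ ∃ i' ∈ s, i' ≠ i ∧ ρ i' = n)).card

/-- The number of free points of a column `j` with set of rows `s`. -/
def columnFree (n j : ℕ) (s : Finset ℕ) : ℕ := (s.filter (fun i => 2 * n + 1 ≤ i + j)).card

theorem mem_columnRows {j i : ℕ} : i ∈ columnRows U j ↔ (j, i) ∈ U := by
  simp only [columnRows, Finset.mem_image, Finset.mem_filter]
  constructor
  · rintro ⟨⟨p1, p2⟩, ⟨h, rfl⟩, rfl⟩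
    exact h
  · exact fun h => ⟨_, ⟨h, rfl⟩, rfl⟩

theorem IsPartial.card_columnRows (hU : IsPartial n k U) {j : ℕ} (h1 : 1 ≤ j) (hk : j ≤ k) :
    (columnRows U j).card = 2 := by
  rw [columnRows, Finset.card_image_of_injOn, hU.card_col j h1 hk]
  intro p hp q hq h
  exact hU.row_inj p (Finset.mem_filter.1 hp).1 q (Finset.mem_filter.1 hq).1 h

theorem IsPartial.root_injOn (hT : IsPartial n n T) {p q : ℕ × ℕ} (hp : p ∈ T) (hq : q ∈ T)
    (h1 : p.1 = q.1) (h : rootVal (2 * n) p.1 T p.2 = rootVal (2 * n) q.1 T q.2) : p = q := by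
  have hb := hT.bounds p hp
  have hb' := hT.bounds q hq
  rw [← h1] at h
  refine hT.row_inj p hp q hq (hT.rootVal_injOn hb.2.1 (by omega) (Finset.mem_Icc.2 (by omega))
    ?_ (Finset.mem_Icc.2 (by omega)) ?_ h)
  · exact fun r hr hrp => by rw [hT.row_inj r hr p hp hrp]
  · exact fun r hr hrq => by rw [hT.row_inj r hr q hq hrq, h1]

theorem IsPartial.root_mem (hT : IsPartial n n T) {p : ℕ × ℕ} (hp : p ∈ T) :
    rootVal (2 * n) p.1 T p.2 ∈ rootSet n p.1 := by
  have hb := hT.bounds p hp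
  obtain ⟨-, -, h, -⟩ := hT.rootVal_spec (j := p.1) (i := p.2) hb.2.1 (by omega)
    (Finset.mem_Icc.2 (by omega)) (fun q hq h => by rw [hT.row_inj q hq p hp h])
  exact h

theorem IsPartial.recSetE_n (hT : IsPartial n n T) (hn : 1 ≤ n) :
    recSetE n T n = (T.filter (fun p => rootVal (2 * n) p.1 T p.2 = n) : Set (ℕ × ℕ)) := by
  ext p
  rw [hT.mem_recSetE (Finset.mem_Icc.2 (by omega)) (fun j hj => mem_rootSet.2 (by omega))]
  simp

theorem IsPartial.recSetE_two_mul (hT : IsPartial n n T) (hn : 1 ≤ n) :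
    recSetE n T (2 * n) =
      (T.filter (fun p => rootVal (2 * n) p.1 T p.2 = 2 * n) : Set (ℕ × ℕ)) := by
  ext p
  rw [hT.mem_recSetE (Finset.mem_Icc.2 (by omega)) (fun j hj => mem_rootSet.2 (by omega))]
  simp

theorem IsPartial.gsetE_eq (hT : IsPartial n n T) (hn : 1 ≤ n) :
    GsetE n T = (T.filter (fun p => 2 * n + 1 ≤ p.2 + p.1 ∧ rootVal (2 * n) p.1 T p.2 = p.1 ∧
      ∃ i' ∈ columnRows T p.1, i' ≠ p.2 ∧ rootVal (2 * n) p.1 T i' = n) : Set (ℕ × ℕ)) := by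
  ext p
  rw [GsetE, hT.recSetE_n hn]
  simp only [Set.mem_ofPred_eq, Finset.coe_filter, mem_columnRows]
  constructor
  · rintro ⟨h1, h2, ⟨⟨q1, q2⟩, hq, rfl, hne, hq', hr⟩, h3⟩
    refine ⟨h1, h2, h3, q2, hq, fun h => hne (by rw [h]), hr⟩
  · rintro ⟨h1, h2, h3, i, hi, hne, hr⟩
    exact ⟨h1, h2, ⟨_, hi, rfl, fun h => hne (by rw [← h]), hi, hr⟩, h3⟩

/-- In column `n` there is exactly one point with each of the two possible roots. -/
theorem IsPartial.card_last_column (hT : IsPartial n n T) (hn : 1 ≤ n) {s : ℕ}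
    (hs : s = n ∨ s = 2 * n) :
    ((columnRows T n).filter (fun i => rootVal (2 * n) n T i = s)).card = 1 := by
  have hinj : Set.InjOn (rootVal (2 * n) n T) (columnRows T n) := by
    intro i hi i' hi' h
    have := hT.root_injOn (mem_columnRows.1 hi) (mem_columnRows.1 hi') rfl h
    simpa using this
  have himg : (columnRows T n).image (rootVal (2 * n) n T) = {n, 2 * n} := by
    refine Finset.eq_of_subset_of_card_le ?_ ?_
    · intro r hr
      obtain ⟨i, hi, rfl⟩ := Finset.mem_image.1 hr
      have := mem_rootSet.1 (hT.root_mem (mem_columnRows.1 hi))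
      simp only [Finset.mem_insert, Finset.mem_singleton]
      simp only at this
      omega
    · rw [Finset.card_image_of_injOn hinj, hT.card_columnRows hn le_rfl]
      exact Finset.card_le_two
  have hs' : s ∈ (columnRows T n).image (rootVal (2 * n) n T) := by
    rw [himg]
    simpa using hs
  obtain ⟨i, hi, rfl⟩ := Finset.mem_image.1 hs'
  refine Finset.card_eq_one.2 ⟨i, ?_⟩
  ext i'
  simp only [Finset.mem_filter, Finset.mem_singleton]
  exact ⟨fun h => hinj h.1 hi h.2, fun h => by rw [h]; exact ⟨hi, rfl⟩⟩

theorem Icc_one_eq_insert (hn : 1 ≤ n) : Finset.Icc 1 n = insert n (Finset.Icc 1 (n - 1)) := by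
  ext i
  simp only [Finset.mem_insert, Finset.mem_Icc]
  omega

theorem IsPartial.rec_card (hT : IsPartial n n T) (hn : 1 ≤ n) {s : ℕ}
    (hs : s = n ∨ s = 2 * n) :
    (T.filter (fun p => rootVal (2 * n) p.1 T p.2 = s)).card =
      1 + ∑ j ∈ Finset.Icc 1 (n - 1),
        ((columnRows T j).filter (fun i => rootVal (2 * n) j T i = s)).card := by
  rw [hT.card_filter _ (S := Finset.Icc 1 n)
    (fun p hp _ => Finset.mem_Icc.2 ⟨(hT.bounds p hp).1, (hT.bounds p hp).2.1⟩),
    Icc_one_eq_insert hn, Finset.sum_insert (by simp; omega)]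
  congr 1
  exact hT.card_last_column hn hs

theorem IsPartial.frE_eq (hT : IsPartial n n T) :
    frE n T = ∑ j ∈ Finset.Icc 1 n, columnFree n j (columnRows T j) := by
  rw [frE, hT.card_filter _ (S := Finset.Icc 1 n)
    (fun p hp _ => Finset.mem_Icc.2 ⟨(hT.bounds p hp).1, (hT.bounds p hp).2.1⟩)]
  rfl

theorem IsPartial.maxStat_eq (hT : IsPartial n n T) (hn : 1 ≤ n) :
    maxStat n T =
      ∑ j ∈ Finset.Icc 1 (n - 1), columnMax n j (columnRows T j) (rootVal (2 * n) j T) := by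
  simp only [columnMax, Finset.sum_add_distrib]
  rw [maxStat, bStat, rStat, gStat, hT.recSetE_n hn, hT.recSetE_two_mul hn, hT.gsetE_eq hn,
    Set.ncard_coe_finset, Set.ncard_coe_finset, Set.ncard_coe_finset,
    hT.rec_card hn (Or.inl rfl), hT.rec_card hn (Or.inr rfl),
    hT.card_filter _ (S := Finset.Icc 1 (n - 1)), Nat.add_sub_cancel_left, Nat.add_sub_cancel_left]
  · rfl
  · rintro p hp ⟨-, h2, i, hi, hne, hi'⟩
    have hb := hT.bounds p hp
    refine Finset.mem_Icc.2 ⟨hb.1, ?_⟩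
    by_contra hcon
    have hpn : p.1 = n := by omega
    refine hne ?_
    have := hT.root_injOn (mem_columnRows.1 hi) hp rfl (by simp only; rw [hi', h2, hpn])
    rw [← this]

/-- The number of free points exceeds `max`. -/
theorem IsPartial.maxStat_lt (hT : IsPartial n n T) (hn : 1 ≤ n) : maxStat n T + 1 ≤ frE n T := by
  rw [maxStat, bStat, rStat, gStat, hT.recSetE_n hn, hT.recSetE_two_mul hn, hT.gsetE_eq hn,
    Set.ncard_coe_finset, Set.ncard_coe_finset, Set.ncard_coe_finset]
  have hR1 := hT.rec_card hn (Or.inr rfl)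
  set B := T.filter (fun p => rootVal (2 * n) p.1 T p.2 = n)
  set R := T.filter (fun p => rootVal (2 * n) p.1 T p.2 = 2 * n)
  set G := T.filter (fun p => 2 * n + 1 ≤ p.2 + p.1 ∧ rootVal (2 * n) p.1 T p.2 = p.1 ∧
      ∃ i' ∈ columnRows T p.1, i' ≠ p.2 ∧ rootVal (2 * n) p.1 T i' = n)
  have hBe : B.card - 1 ≤ (B.erase (rowPt T n)).card := Finset.pred_card_le_card_erase
  have hGn : ∀ p ∈ G, p.1 ≠ n := by
    intro p hp hpn
    obtain ⟨hp, h1, h2, i, hi, hne, hi'⟩ := Finset.mem_filter.1 hp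
    refine hne ?_
    have := hT.root_injOn (mem_columnRows.1 hi) hp rfl (by simp only; rw [hi', h2, hpn])
    rw [← this]
  have hBR : Disjoint (B.erase (rowPt T n)) R := by
    rw [Finset.disjoint_left]
    intro p hp hp'
    have h1 := (Finset.mem_filter.1 (Finset.mem_of_mem_erase hp)).2
    have h2 := (Finset.mem_filter.1 hp').2
    omega
  have hBRG : Disjoint (B.erase (rowPt T n) ∪ R) G := by
    rw [Finset.disjoint_left]
    intro p hp hpG
    have h0 := hGn p hpG
    have hG := (Finset.mem_filter.1 hpG).2.2.1
    have hb := hT.bounds p (Finset.mem_filter.1 hpG).1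
    rcases Finset.mem_union.1 hp with hp | hp
    · have h1 := (Finset.mem_filter.1 (Finset.mem_of_mem_erase hp)).2
      omega
    · have h1 := (Finset.mem_filter.1 hp).2
      omega
  have hself : ∀ p ∈ T, ¬ 2 * n + 1 ≤ p.2 + p.1 → rootVal (2 * n) p.1 T p.2 = p.2 := by
    intro p hp h
    have hb := hT.bounds p hp
    exact rootVal_of_mem (mem_rootSet.2 (by omega))
  have hsub : (B.erase (rowPt T n) ∪ R) ∪ G ⊆ T.filter (fun p => 2 * n + 1 ≤ p.2 + p.1) := by
    intro p hp
    rcases Finset.mem_union.1 hp with hp | hp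
    · rcases Finset.mem_union.1 hp with hp | hp
      · obtain ⟨hne, hp⟩ := Finset.mem_erase.1 hp
        obtain ⟨hpT, h1⟩ := Finset.mem_filter.1 hp
        refine Finset.mem_filter.2 ⟨hpT, ?_⟩
        by_contra hcon
        rw [hself p hpT hcon] at h1
        exact hne (by rw [← h1, hT.rowPt_eq hpT])
      · obtain ⟨hpT, h1⟩ := Finset.mem_filter.1 hp
        refine Finset.mem_filter.2 ⟨hpT, ?_⟩
        by_contra hcon
        rw [hself p hpT hcon] at h1
        have := hT.bounds p hpT
        omega
    · exact Finset.mem_filter.2 ⟨(Finset.mem_filter.1 hp).1, (Finset.mem_filter.1 hp).2.1⟩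
  have hle := Finset.card_le_card hsub
  rw [Finset.card_union_of_disjoint hBRG, Finset.card_union_of_disjoint hBR] at hle
  rw [frE]
  omega

/-! ### Adding a column -/

/-- The finite set of partial configurations with `k` columns. -/
noncomputable def partials (n k : ℕ) : Finset (Finset (ℕ × ℕ)) :=
  ((Finset.Icc 1 k ×ˢ Finset.Icc 1 (2 * n)).powerset).filter (IsPartial n k)

theorem mem_partials : U ∈ partials n k ↔ IsPartial n k U := by
  rw [partials, Finset.mem_filter, Finset.mem_powerset]
  refine ⟨fun h => h.2, fun h => ⟨fun p hp => ?_, h⟩⟩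
  have := h.bounds p hp
  rw [Finset.mem_product, Finset.mem_Icc, Finset.mem_Icc]
  omega

theorem tneF_eq_partials : TneF n = partials n n := by
  rw [TneF, partials]
  exact Finset.filter_congr fun T _ => isTne_iff

/-- `U` together with points in the rows `s` of column `j`. -/
noncomputable def addColumn (U : Finset (ℕ × ℕ)) (j : ℕ) (s : Finset ℕ) : Finset (ℕ × ℕ) :=
  U ∪ s.image (Prod.mk j)

/-- The possible sets of rows of column `j` after `U`. -/
noncomputable def nextColumns (n j : ℕ) (U : Finset (ℕ × ℕ)) : Finset (Finset ℕ) :=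
  ((emptyRows n U).powersetCard 2).filter (fun s => j ∈ U.image Prod.snd ∨ j ∈ s)

theorem mem_addColumn {j : ℕ} {s : Finset ℕ} {p : ℕ × ℕ} :
    p ∈ addColumn U j s ↔ p ∈ U ∨ p.1 = j ∧ p.2 ∈ s := by
  rw [addColumn, Finset.mem_union, Finset.mem_image]
  refine or_congr_right ⟨?_, ?_⟩
  · rintro ⟨i, hi, rfl⟩
    exact ⟨rfl, hi⟩
  · rintro ⟨h, hi⟩
    exact ⟨p.2, hi, by rw [← h]⟩

theorem image_snd_addColumn (j : ℕ) (s : Finset ℕ) :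
    (addColumn U j s).image Prod.snd = U.image Prod.snd ∪ s := by
  rw [addColumn, Finset.image_union, Finset.image_image]
  congr 1
  exact Finset.image_id

theorem columnRows_addColumn_of_ne {c j : ℕ} (h : c ≠ j) (s : Finset ℕ) :
    columnRows (addColumn U j s) c = columnRows U c := by
  ext i
  rw [mem_columnRows, mem_columnRows, mem_addColumn]
  simp [h]

theorem IsPartial.columnRows_addColumn (hU : IsPartial n k U) (s : Finset ℕ) :
    columnRows (addColumn U (k + 1) s) (k + 1) = s := by
  ext i
  rw [mem_columnRows, mem_addColumn]
  constructor
  · rintro (h | h)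
    · have := (hU.bounds _ h).2.1
      simp only at this
      omega
    · exact h.2
  · exact fun h => Or.inr ⟨rfl, h⟩

theorem rootVal_addColumn {c j : ℕ} (hc : c ≤ j) (hj : j ≤ 2 * n) (s : Finset ℕ) :
    rootVal (2 * n) c (addColumn U j s) = rootVal (2 * n) c U := by
  refine rootVal_congr fun d hd i => ?_
  rw [mem_addColumn]
  simp only [or_iff_left_iff_imp]
  rintro ⟨h, -⟩
  omega

theorem IsPartial.lt_of_mem_emptyRows (hU : IsPartial n k U) {i : ℕ} (hi : i ∈ emptyRows n U) :
    k < i := by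
  rw [emptyRows, Finset.mem_sdiff, Finset.mem_Icc] at hi
  by_contra h
  exact hi.2 (hU.filled i hi.1.1 (by omega))

theorem IsPartial.addColumn (hU : IsPartial n k U) {s : Finset ℕ}
    (hs : s ∈ nextColumns n (k + 1) U) : IsPartial n (k + 1) (addColumn U (k + 1) s) := by
  obtain ⟨hs, hf⟩ := Finset.mem_filter.1 hs
  obtain ⟨hsub, hcard⟩ := Finset.mem_powersetCard.1 hs
  refine ⟨fun p hp => ?_, fun p hp q hq h => ?_, fun j h1 hj => ?_, fun i h1 hi => ?_⟩
  · rcases mem_addColumn.1 hp with hp | ⟨h1, h2⟩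
    · have := hU.bounds p hp
      omega
    · have h3 := hU.lt_of_mem_emptyRows (hsub h2)
      have h4 := Finset.mem_Icc.1 (Finset.mem_sdiff.1 (hsub h2)).1
      omega
  · have key : ∀ p ∈ U, ∀ q : ℕ × ℕ, q.2 ∈ s → p.2 ≠ q.2 := fun p hp q hq h =>
      (Finset.mem_sdiff.1 (hsub hq)).2 (Finset.mem_image.2 ⟨p, hp, h⟩)
    rcases mem_addColumn.1 hp with hp | ⟨h1, h2⟩ <;>
    rcases mem_addColumn.1 hq with hq | ⟨h3, h4⟩
    · exact hU.row_inj p hp q hq h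
    · exact absurd h (key p hp q h4)
    · exact absurd h.symm (key q hq p h2)
    · exact Prod.ext (h1.trans h3.symm) h
  · have hcol : ((SymDellac.addColumn U (k + 1) s).filter (fun p => p.1 = j)) =
        if j = k + 1 then s.image (Prod.mk (k + 1)) else U.filter (fun p => p.1 = j) := by
      ext p
      rw [Finset.mem_filter, mem_addColumn]
      split_ifs with h
      · subst h
        rw [Finset.mem_image]
        constructor
        · rintro ⟨h | h, h'⟩
          · have := hU.bounds _ h
            omega
          · exact ⟨p.2, h.2, by rw [← h']⟩
        · rintro ⟨i, hi, rfl⟩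
          exact ⟨Or.inr ⟨rfl, hi⟩, rfl⟩
      · rw [Finset.mem_filter]
        constructor
        · rintro ⟨h | h, h'⟩
          · exact ⟨h, h'⟩
          · omega
        · rintro ⟨h, h'⟩
          exact ⟨Or.inl h, h'⟩
    rw [hcol]
    split_ifs with h
    · rw [Finset.card_image_of_injective _ (Prod.mk_right_injective _), hcard]
    · exact hU.card_col j h1 (by omega)
  · rw [image_snd_addColumn, Finset.mem_union]
    rcases Nat.lt_or_ge k i with h | h
    · rwa [show i = k + 1 by omega]
    · exact Or.inl (hU.filled i h1 h)

theorem IsPartial.restrict (hU : IsPartial n (k + 1) U) :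
    IsPartial n k (U.filter (fun p => p.1 ≤ k)) := by
  refine ⟨fun p hp => ?_, fun p hp q hq h => ?_, fun j h1 hj => ?_, fun i h1 hi => ?_⟩
  · obtain ⟨hp, h⟩ := Finset.mem_filter.1 hp
    have := hU.bounds p hp
    omega
  · exact hU.row_inj p (Finset.mem_filter.1 hp).1 q (Finset.mem_filter.1 hq).1 h
  · rw [← hU.card_col j h1 (by omega), Finset.filter_filter]
    congr 1
    ext p
    simp only [Finset.mem_filter, and_congr_right_iff]
    intro _
    omega
  · obtain ⟨p, hp, rfl⟩ := Finset.mem_image.1 (hU.filled i h1 (by omega))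
    have := hU.bounds p hp
    exact Finset.mem_image.2 ⟨p, Finset.mem_filter.2 ⟨hp, by omega⟩, rfl⟩

theorem IsPartial.columnRows_mem_nextColumns (hU : IsPartial n (k + 1) U) :
    columnRows U (k + 1) ∈ nextColumns n (k + 1) (U.filter (fun p => p.1 ≤ k)) := by
  refine Finset.mem_filter.2 ⟨Finset.mem_powersetCard.2
    ⟨fun i hi => ?_, hU.card_columnRows (by omega) le_rfl⟩, ?_⟩
  · rw [mem_columnRows] at hi
    have hb := hU.bounds _ hi
    refine Finset.mem_sdiff.2 ⟨Finset.mem_Icc.2 (by simp only at hb; omega), fun hcon => ?_⟩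
    obtain ⟨p, hp, h⟩ := Finset.mem_image.1 hcon
    obtain ⟨hp, hp'⟩ := Finset.mem_filter.1 hp
    rw [hU.row_inj p hp _ hi h] at hp'
    simp only at hp'
    omega
  · obtain ⟨p, hp, h⟩ := Finset.mem_image.1 (hU.filled (k + 1) (by omega) le_rfl)
    have hb := hU.bounds p hp
    by_cases h1 : p.1 ≤ k
    · exact Or.inl (Finset.mem_image.2 ⟨p, Finset.mem_filter.2 ⟨hp, h1⟩, h⟩)
    · refine Or.inr (mem_columnRows.2 ?_)
      rwa [← show p = (k + 1, k + 1) from Prod.ext (by simp only; omega) h]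

theorem sum_partials_succ {M : Type*} [AddCommMonoid M] (F : Finset (ℕ × ℕ) → M) :
    ∑ V ∈ partials n (k + 1), F V =
      ∑ U ∈ partials n k, ∑ s ∈ nextColumns n (k + 1) U, F (addColumn U (k + 1) s) := by
  rw [Finset.sum_sigma']
  symm
  refine Finset.sum_bij' (fun x _ => addColumn x.1 (k + 1) x.2)
    (fun V _ => ⟨V.filter (fun p => p.1 ≤ k), columnRows V (k + 1)⟩) ?_ ?_ ?_ ?_ ?_
  · rintro ⟨U, s⟩ h
    obtain ⟨hU, hs⟩ := Finset.mem_sigma.1 h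
    exact mem_partials.2 ((mem_partials.1 hU).addColumn hs)
  · intro V hV
    rw [mem_partials] at hV
    exact Finset.mem_sigma.2 ⟨mem_partials.2 hV.restrict, hV.columnRows_mem_nextColumns⟩
  · rintro ⟨U, s⟩ h
    obtain ⟨hU, hs⟩ := Finset.mem_sigma.1 h
    have hU := mem_partials.1 hU
    simp only
    have h1 : (addColumn U (k + 1) s).filter (fun p => p.1 ≤ k) = U := by
      ext p
      rw [Finset.mem_filter, mem_addColumn]
      constructor
      · rintro ⟨h | h, h'⟩
        · exact h
        · omega
      · exact fun h => ⟨Or.inl h, (hU.bounds p h).2.1⟩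
    rw [h1, hU.columnRows_addColumn]
  · intro V hV
    rw [mem_partials] at hV
    ext p
    simp only [mem_addColumn, Finset.mem_filter, mem_columnRows]
    constructor
    · rintro (h | ⟨h, h'⟩)
      · exact h.1
      · rwa [← h] at h'
    · intro h
      have hb := hV.bounds p h
      by_cases h1 : p.1 ≤ k
      · exact Or.inl ⟨h, h1⟩
      · have h2 : p.1 = k + 1 := by omega
        exact Or.inr ⟨h2, by rwa [← h2]⟩
  · intro x _
    rfl

/-! ### Sums over pairs -/

theorem two_mul_sum_pairs {ι : Type*} [DecidableEq ι] (E : Finset ι) (w : ι → ℚ) :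
    2 * ∑ s ∈ E.powersetCard 2, ∏ i ∈ s, w i = (∑ i ∈ E, w i) ^ 2 - ∑ i ∈ E, w i ^ 2 := by
  induction E using Finset.induction_on with
  | empty =>
    rw [Finset.powersetCard_eq_empty.2 (by simp)]
    simp
  | insert a E ha ih =>
    rw [Finset.powersetCard_succ_insert ha, Finset.sum_union, mul_add, ih, Finset.sum_insert ha,
      Finset.sum_insert ha, Finset.sum_image]
    · have : ∑ s ∈ E.powersetCard 1, ∏ i ∈ insert a s, w i = w a * ∑ i ∈ E, w i := by
        rw [Finset.powersetCard_one, Finset.sum_map, Finset.mul_sum]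
        refine Finset.sum_congr rfl fun i hi => ?_
        rw [Function.Embedding.coeFn_mk, Finset.prod_insert, Finset.prod_singleton]
        simp only [Finset.mem_singleton]
        rintro rfl
        exact ha hi
      rw [this]
      ring
    · intro s hs t ht h
      have hs' : a ∉ s := fun h => ha ((Finset.mem_powersetCard.1 hs).1 h)
      have ht' : a ∉ t := fun h => ha ((Finset.mem_powersetCard.1 ht).1 h)
      rw [← Finset.erase_insert hs', h, Finset.erase_insert ht']
    · rw [Finset.disjoint_left]
      intro s hs hs'
      obtain ⟨t, -, rfl⟩ := Finset.mem_image.1 hs'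
      exact ha ((Finset.mem_powersetCard.1 hs).1 (Finset.mem_insert_self _ _))

theorem sum_pairs_containing {ι : Type*} [DecidableEq ι] {E : Finset ι} (w : ι → ℚ) {a : ι}
    (ha : a ∈ E) :
    ∑ s ∈ (E.powersetCard 2).filter (fun s => a ∈ s), ∏ i ∈ s, w i =
      w a * (∑ i ∈ E, w i - w a) := by
  have h1 := two_mul_sum_pairs E w
  have h2 := two_mul_sum_pairs (E.erase a) w
  rw [← Finset.sum_filter_add_sum_filter_not _ (fun s => a ∈ s)] at h1
  have h3 : (E.powersetCard 2).filter (fun s => a ∉ s) = (E.erase a).powersetCard 2 := by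
    ext s
    simp only [Finset.mem_filter, Finset.mem_powersetCard, Finset.subset_erase]
    tauto
  rw [h3] at h1
  rw [← Finset.add_sum_erase _ _ ha, ← Finset.add_sum_erase _ (fun i => w i ^ 2) ha] at h1
  rw [← Finset.add_sum_erase _ _ ha]
  linear_combination (1/2) * h1 - (1/2) * h2

theorem sum_eq_of_four {ι : Type*} [DecidableEq ι] {S : Finset ι} {f : ι → ℚ} {a b c d : ι}
    {κ : ℚ} (ha : a ∈ S) (hb : b ∈ S) (hc : c ∈ S) (hd : d ∈ S) (hab : a ≠ b) (hac : a ≠ c)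
    (had : a ≠ d) (hbc : b ≠ c) (hbd : b ≠ d) (hcd : c ≠ d)
    (h : ∀ r ∈ S, r ≠ a → r ≠ b → r ≠ c → r ≠ d → f r = κ) :
    ∑ r ∈ S, f r = f a + f b + f c + f d + κ * (S.card - 4) := by
  have hcard : ({a, b, c, d} : Finset ι).card = 4 := by
    rw [Finset.card_insert_of_notMem (by simp [hab, hac, had]),
      Finset.card_insert_of_notMem (by simp [hbc, hbd]), Finset.card_pair hcd]
  have hsub : ({a, b, c, d} : Finset ι) ⊆ S := by
    intro x hx
    simp only [Finset.mem_insert, Finset.mem_singleton] at hx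
    rcases hx with rfl | rfl | rfl | rfl <;> assumption
  have hcs := Finset.card_sdiff_add_card_eq_card hsub
  rw [hcard] at hcs
  rw [← Finset.sum_sdiff hsub, Finset.sum_congr rfl (g := fun _ => κ), Finset.sum_const,
    Finset.sum_insert (by simp [hab, hac, had]), Finset.sum_insert (by simp [hbc, hbd]),
    Finset.sum_pair hcd, ← hcs]
  · push_cast
    rw [nsmul_eq_mul]
    ring
  · intro r hr
    simp only [Finset.mem_sdiff, Finset.mem_insert, Finset.mem_singleton, not_or] at hr
    exact h r hr.1 hr.2.1 hr.2.2.1 hr.2.2.2.1 hr.2.2.2.2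

theorem pow_card_filter {ι : Type*} (s : Finset ι) (Q : ι → Prop) [DecidablePred Q] (z : ℚ) :
    z ^ (s.filter Q).card = ∏ i ∈ s, if Q i then z else 1 := by
  rw [Finset.prod_ite, Finset.prod_const, Finset.prod_const_one, mul_one]

/-! ### Roots of empty rows -/

theorem IsPartial.not_mem_of_mem_emptyRows {i j : ℕ} (hi : i ∈ emptyRows n U) :
    ∀ p ∈ U, p.2 = i → j ≤ p.1 := fun p hp h =>
  absurd (Finset.mem_image.2 ⟨p, hp, h⟩) (Finset.mem_sdiff.1 hi).2

theorem mem_Icc_of_mem_emptyRows {i : ℕ} (hi : i ∈ emptyRows n U) : i ∈ Finset.Icc 1 (2 * n) :=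
  (Finset.mem_sdiff.1 hi).1

theorem IsPartial.rootVal_mem_rootSet (hU : IsPartial n k U) (hk : k + 1 ≤ n) {i : ℕ}
    (hi : i ∈ emptyRows n U) : rootVal (2 * n) (k + 1) U i ∈ rootSet n (k + 1) := by
  obtain ⟨-, -, h, -⟩ := hU.rootVal_spec hk le_rfl (mem_Icc_of_mem_emptyRows hi)
    (not_mem_of_mem_emptyRows hi)
  exact h

theorem IsPartial.rootVal_injOn_emptyRows (hU : IsPartial n k U) (hk : k + 1 ≤ n) :
    Set.InjOn (rootVal (2 * n) (k + 1) U) (emptyRows n U) := fun _ hi _ hi' h =>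
  hU.rootVal_injOn hk le_rfl (mem_Icc_of_mem_emptyRows hi) (not_mem_of_mem_emptyRows hi)
    (mem_Icc_of_mem_emptyRows hi') (not_mem_of_mem_emptyRows hi') h

theorem card_rootSet {j : ℕ} (h1 : 1 ≤ j) (hj : j ≤ n) :
    (rootSet n j).card = 2 * n - 2 * j + 2 := by
  rw [rootSet, Finset.card_insert_of_notMem (by rw [Finset.mem_Icc]; omega), Nat.card_Icc]
  omega

theorem IsPartial.image_rootVal (hU : IsPartial n k U) (hk : k + 1 ≤ n) :
    (emptyRows n U).image (rootVal (2 * n) (k + 1) U) = rootSet n (k + 1) := by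
  refine Finset.eq_of_subset_of_card_le ?_ ?_
  · intro r hr
    obtain ⟨i, hi, rfl⟩ := Finset.mem_image.1 hr
    exact hU.rootVal_mem_rootSet hk hi
  · rw [Finset.card_image_of_injOn (hU.rootVal_injOn_emptyRows hk), hU.card_emptyRows,
      card_rootSet (by omega) hk]
    omega

/-- An empty row is its own root `r` exactly if row `r` is empty. -/
theorem IsPartial.eq_iff_rootVal (hU : IsPartial n k U) (hk : k + 1 ≤ n) {i r : ℕ}
    (hi : i ∈ emptyRows n U) (hr : k + 1 ≤ r) (hr' : r ≤ 2 * n - (k + 1)) :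
    i = r ↔ rootVal (2 * n) (k + 1) U i = r ∧ r ∉ U.image Prod.snd := by
  have hself : rootVal (2 * n) (k + 1) U r = r := rootVal_of_mem (mem_rootSet.2 (Or.inr ⟨hr, hr'⟩))
  constructor
  · rintro rfl
    exact ⟨hself, (Finset.mem_sdiff.1 hi).2⟩
  · rintro ⟨h1, h2⟩
    exact hU.rootVal_injOn_emptyRows hk hi
      (Finset.mem_coe.2 (Finset.mem_sdiff.2 ⟨Finset.mem_Icc.2 (by omega), h2⟩))
      (h1.trans hself.symm)

/-- An empty row with root `r` below the top row is free exactly if row `r` is nonempty. -/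
theorem IsPartial.free_iff (hU : IsPartial n k U) (hk : k + 1 ≤ n) {i r : ℕ}
    (hi : i ∈ emptyRows n U) (hr' : r ≤ 2 * n - (k + 1))
    (h : rootVal (2 * n) (k + 1) U i = r) :
    2 * n + 1 ≤ i + (k + 1) ↔ r ∈ U.image Prod.snd := by
  have hlt := hU.lt_of_mem_emptyRows hi
  constructor
  · intro hf
    by_cases h2 : i = 2 * n
    · rw [rootVal_of_mem (mem_rootSet.2 (Or.inl h2))] at h
      omega
    · rw [← h]
      exact hU.rootVal_mem_of_ne hk le_rfl (mem_Icc_of_mem_emptyRows hi)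
        (not_mem_of_mem_emptyRows hi) (by rw [mem_rootSet]; omega)
  · intro hf
    by_contra hcon
    rw [rootVal_of_mem (mem_rootSet.2 (by omega))] at h
    exact (Finset.mem_sdiff.1 hi).2 (h ▸ hf)

/-- Transport of a sum over empty rows to a sum over roots. -/
theorem IsPartial.sum_emptyRows (hU : IsPartial n k U) (hk : k + 1 ≤ n) {O : Finset ℕ}
    (hO : O ⊆ Finset.Icc (k + 1) (2 * n - (k + 1))) (hUO : Disjoint (U.image Prod.snd) O)
    (f : ℕ → ℚ) :
    ∑ i ∈ emptyRows n U \ O, f (rootVal (2 * n) (k + 1) U i) =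
      ∑ r ∈ rootSet n (k + 1) \ O, f r := by
  refine Finset.sum_nbij (rootVal (2 * n) (k + 1) U) ?_ ?_ ?_ (fun _ _ => rfl)
  · intro i hi
    obtain ⟨hi, hiO⟩ := Finset.mem_sdiff.1 hi
    refine Finset.mem_sdiff.2 ⟨hU.rootVal_mem_rootSet hk hi, fun hr => ?_⟩
    have hI := Finset.mem_Icc.1 (hO hr)
    have := (hU.eq_iff_rootVal hk hi hI.1 hI.2).2 ⟨rfl, Finset.disjoint_right.1 hUO hr⟩
    exact hiO (this ▸ hr)
  · exact (hU.rootVal_injOn_emptyRows hk).mono (by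
      rw [Finset.coe_subset]
      exact Finset.sdiff_subset)
  · intro r hr
    obtain ⟨hr, hrO⟩ := Finset.mem_sdiff.1 (Finset.mem_coe.1 hr)
    rw [← hU.image_rootVal hk] at hr
    obtain ⟨i, hi, rfl⟩ := Finset.mem_image.1 hr
    refine ⟨i, Finset.mem_coe.2 (Finset.mem_sdiff.2 ⟨hi, fun hiO => hrO ?_⟩), rfl⟩
    have hI := Finset.mem_Icc.1 (hO hiO)
    rwa [rootVal_of_mem (mem_rootSet.2 (Or.inr hI))]

/-! ### The sum over the next column -/

/-- The weight of a root `r` in column `j`, where `F` is the set of filled rows. -/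
noncomputable def rootWeight (n j : ℕ) (F : Finset ℕ) (z : ℚ) (r : ℕ) : ℚ :=
  (if (r = j ∨ r = 2 * n - j) ∧ r ∉ F then 1 else 2) * (if r = n then z else 1) *
    (if r = 2 * n then z else 1)

theorem IsPartial.card_free_add (hU : IsPartial n k U) (hk : k + 1 ≤ n) {s : Finset ℕ}
    (hs : s ⊆ emptyRows n U) :
    columnFree n (k + 1) s +
        ((U.image Prod.snd ∪ s) ∩ Finset.Icc (k + 2) (2 * n - (k + 2))).card =
      (U.image Prod.snd ∩ Finset.Icc (k + 2) (2 * n - (k + 2))).card +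
        (s.filter (fun i => ¬ (i = k + 1 ∨ i = 2 * n - (k + 1)))).card := by
  rw [Finset.union_inter_distrib_right, Finset.card_union_of_disjoint, Nat.add_left_comm,
    columnFree, ← Finset.card_union_of_disjoint]
  · congr 2
    ext i
    simp only [Finset.mem_union, Finset.mem_filter, Finset.mem_inter, Finset.mem_Icc]
    constructor
    · rintro (⟨h, h'⟩ | ⟨h, h'⟩)
      · exact ⟨h, by omega⟩
      · exact ⟨h, by omega⟩
    · rintro ⟨h, h'⟩
      have := hU.lt_of_mem_emptyRows (hs h)
      by_cases hf : 2 * n + 1 ≤ i + (k + 1)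
      · exact Or.inl ⟨h, hf⟩
      · exact Or.inr ⟨h, by omega⟩
  · rw [Finset.disjoint_left]
    intro i hi
    simp only [Finset.mem_filter, Finset.mem_inter, Finset.mem_Icc] at hi ⊢
    omega
  · rw [Finset.disjoint_left]
    intro i hi hi'
    exact (Finset.mem_sdiff.1 (hs (Finset.mem_inter.1 hi').1)).2 (Finset.mem_inter.1 hi).1

theorem IsPartial.rootWeight_rootVal (hU : IsPartial n k U) (hk : k + 1 ≤ n) (z : ℚ) {i : ℕ}
    (hi : i ∈ emptyRows n U) :
    rootWeight n (k + 1) (U.image Prod.snd) z (rootVal (2 * n) (k + 1) U i) =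
      (if ¬ (i = k + 1 ∨ i = 2 * n - (k + 1)) then 2 else 1) *
        (if rootVal (2 * n) (k + 1) U i = n then z else 1) *
        (if rootVal (2 * n) (k + 1) U i = 2 * n then z else 1) := by
  have h1 := hU.eq_iff_rootVal hk hi (r := k + 1) le_rfl (by omega)
  have h2 := hU.eq_iff_rootVal hk hi (r := 2 * n - (k + 1)) (by omega) le_rfl
  have h : ((rootVal (2 * n) (k + 1) U i = k + 1 ∨
      rootVal (2 * n) (k + 1) U i = 2 * n - (k + 1)) ∧
      rootVal (2 * n) (k + 1) U i ∉ U.image Prod.snd) ↔ (i = k + 1 ∨ i = 2 * n - (k + 1)) := by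
    rw [h1, h2]
    constructor
    · rintro ⟨h | h, h'⟩
      · exact Or.inl ⟨h, h ▸ h'⟩
      · exact Or.inr ⟨h, h ▸ h'⟩
    · rintro (⟨h, h'⟩ | ⟨h, h'⟩)
      · exact ⟨Or.inl h, h.symm ▸ h'⟩
      · exact ⟨Or.inr h, h.symm ▸ h'⟩
  rw [rootWeight, if_congr h rfl rfl, ite_not]

theorem IsPartial.card_gap (hU : IsPartial n k U) (hk : k + 1 ≤ n) {s : Finset ℕ} {a b : ℕ}
    (hs : s ⊆ emptyRows n U) (hcard : s.card = 2) (ha : a ∈ emptyRows n U)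
    (hb : b ∈ emptyRows n U) (ha' : rootVal (2 * n) (k + 1) U a = k + 1)
    (hb' : rootVal (2 * n) (k + 1) U b = n) (hab : a ≠ b) :
    (s.filter (fun i => 2 * n + 1 ≤ i + (k + 1) ∧ rootVal (2 * n) (k + 1) U i = k + 1 ∧
      ∃ i' ∈ s, i' ≠ i ∧ rootVal (2 * n) (k + 1) U i' = n)).card =
      if k + 1 ∈ U.image Prod.snd ∧ s = {a, b} then 1 else 0 := by
  have hinj := hU.rootVal_injOn_emptyRows hk
  have hfree := hU.free_iff hk ha (by omega) ha'
  split_ifs with h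
  · obtain ⟨hF, rfl⟩ := h
    rw [Finset.card_eq_one]
    refine ⟨a, ?_⟩
    ext i
    simp only [Finset.mem_filter, Finset.mem_singleton]
    constructor
    · rintro ⟨hi, -, hr, -⟩
      exact hinj (hs hi) ha (hr.trans ha'.symm)
    · rintro rfl
      exact ⟨by simp, hfree.2 hF, ha', b, by simp, hab.symm, hb'⟩
  · rw [Finset.card_eq_zero, Finset.filter_eq_empty_iff]
    rintro i hi ⟨hf, hr, i', hi', hne, hr'⟩
    obtain rfl : i = a := hinj (hs hi) ha (hr.trans ha'.symm)
    obtain rfl : i' = b := hinj (hs hi') hb (hr'.trans hb'.symm)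
    refine h ⟨hfree.1 hf, (Finset.eq_of_subset_of_card_le ?_ ?_).symm⟩
    · intro x hx
      simp only [Finset.mem_insert, Finset.mem_singleton] at hx
      rcases hx with rfl | rfl <;> assumption
    · rw [hcard, Finset.card_pair hab]

theorem IsPartial.weight_eq (hU : IsPartial n k U) (hk : k + 1 ≤ n) {s : Finset ℕ} {a b : ℕ}
    (hs : s ⊆ emptyRows n U) (hcard : s.card = 2) (ha : a ∈ emptyRows n U)
    (hb : b ∈ emptyRows n U) (ha' : rootVal (2 * n) (k + 1) U a = k + 1)
    (hb' : rootVal (2 * n) (k + 1) U b = n) (hab : a ≠ b) (z : ℚ) :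
    2 ^ columnFree n (k + 1) s * z ^ columnMax n (k + 1) s (rootVal (2 * n) (k + 1) U) *
        2 ^ ((U.image Prod.snd ∪ s) ∩ Finset.Icc (k + 2) (2 * n - (k + 2))).card =
      2 ^ (U.image Prod.snd ∩ Finset.Icc (k + 2) (2 * n - (k + 2))).card *
        ((∏ i ∈ s, rootWeight n (k + 1) (U.image Prod.snd) z (rootVal (2 * n) (k + 1) U i)) *
          if k + 1 ∈ U.image Prod.snd ∧ s = {a, b} then z else 1) := by
  rw [mul_right_comm, ← pow_add, hU.card_free_add hk hs, columnMax,
    hU.card_gap hk hs hcard ha hb ha' hb' hab, pow_add, pow_add, pow_add,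
    pow_card_filter s _ (2 : ℚ), pow_card_filter, pow_card_filter,
    Finset.prod_congr rfl fun i hi => hU.rootWeight_rootVal hk z (hs hi),
    Finset.prod_mul_distrib, Finset.prod_mul_distrib]
  split_ifs <;> ring

theorem sum_rootWeight_pow (hk : k + 2 ≤ n) {O : Finset ℕ} (F : Finset ℕ)
    (hO : O ⊆ Finset.Icc (k + 2) (2 * n - (k + 2))) (hnO : n ∉ O) (z : ℚ) (m : ℕ) :
    ∑ r ∈ rootSet n (k + 1) \ O, rootWeight n (k + 1) F z r ^ m =
      (if k + 1 ∈ F then 2 else 1) ^ m + (if 2 * n - (k + 1) ∈ F then 2 else 1) ^ m +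
        2 * (2 * z) ^ m + 2 ^ m * (2 * n - 2 * k - O.card - 4) := by
  have hI : ∀ {x}, x ∈ O → k + 2 ≤ x ∧ x ≤ 2 * n - (k + 2) := fun hx =>
    Finset.mem_Icc.1 (hO hx)
  have hmem : ∀ {x}, x ∈ rootSet n (k + 1) \ O ↔
      (x = 2 * n ∨ (k + 1 ≤ x ∧ x ≤ 2 * n - (k + 1))) ∧ x ∉ O := by
    intro x
    rw [Finset.mem_sdiff, mem_rootSet]
  have hsub : O ⊆ rootSet n (k + 1) := fun x hx => mem_rootSet.2 (by
    have := hI hx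
    omega)
  have hcard : ((rootSet n (k + 1) \ O).card : ℚ) = 2 * n - 2 * k - O.card := by
    have := Finset.card_sdiff_add_card_eq_card hsub
    rw [card_rootSet (by omega) (by omega)] at this
    have h' : (rootSet n (k + 1) \ O).card + O.card + 2 * k = 2 * n := by omega
    rw [eq_sub_iff_add_eq, eq_sub_iff_add_eq]
    exact_mod_cast h'
  rw [sum_eq_of_four (a := k + 1) (b := 2 * n - (k + 1)) (c := n) (d := 2 * n) (κ := 2 ^ m)
    (hmem.2 ⟨by omega, fun h => by have := hI h; omega⟩)
    (hmem.2 ⟨by omega, fun h => by have := hI h; omega⟩)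
    (hmem.2 ⟨by omega, hnO⟩)
    (hmem.2 ⟨by omega, fun h => by have := hI h; omega⟩)
    (by omega) (by omega) (by omega) (by omega) (by omega) (by omega), hcard]
  · have e1 : rootWeight n (k + 1) F z (k + 1) = if k + 1 ∈ F then 2 else 1 := by
      rw [rootWeight, if_neg (show k + 1 ≠ n by omega), if_neg (show k + 1 ≠ 2 * n by omega)]
      by_cases h : k + 1 ∈ F <;> simp [h]
    have e2 : rootWeight n (k + 1) F z (2 * n - (k + 1)) =
        if 2 * n - (k + 1) ∈ F then 2 else 1 := by
      rw [rootWeight, if_neg (show 2 * n - (k + 1) ≠ n by omega),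
        if_neg (show 2 * n - (k + 1) ≠ 2 * n by omega)]
      by_cases h : 2 * n - (k + 1) ∈ F <;> simp [h]
    have e3 : rootWeight n (k + 1) F z n = 2 * z := by
      rw [rootWeight, if_neg (by omega), if_pos rfl, if_neg (by omega), mul_one]
    have e4 : rootWeight n (k + 1) F z (2 * n) = 2 * z := by
      rw [rootWeight, if_neg (by omega), if_neg (by omega), if_pos rfl, mul_one]
    rw [e1, e2, e3, e4]
    ring
  · intro r _ h1 h2 h3 h4
    rw [rootWeight, if_neg (by tauto), if_neg h3, if_neg h4, mul_one, mul_one]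

theorem IsPartial.sum_nextColumns_disjoint (hU : IsPartial n k U) (hk : k + 2 ≤ n) {O : Finset ℕ}
    (hO : O ⊆ Finset.Icc (k + 2) (2 * n - (k + 2))) (hnO : n ∉ O)
    (hUO : Disjoint (U.image Prod.snd) O) (z : ℚ) {a b : ℕ}
    (ha : a ∈ emptyRows n U) (hb : b ∈ emptyRows n U)
    (ha' : rootVal (2 * n) (k + 1) U a = k + 1)
    (hb' : rootVal (2 * n) (k + 1) U b = n) (hab : a ≠ b) :
    2 * ∑ s ∈ ((emptyRows n U \ O).powersetCard 2).filter
        (fun s => k + 1 ∈ U.image Prod.snd ∨ k + 1 ∈ s),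
      (∏ i ∈ s, rootWeight n (k + 1) (U.image Prod.snd) z (rootVal (2 * n) (k + 1) U i)) *
          (if k + 1 ∈ U.image Prod.snd ∧ s = {a, b} then z else 1) =
      if k + 1 ∈ U.image Prod.snd then
        (2 + (if 2 * n - (k + 1) ∈ U.image Prod.snd then 2 else 1) + 4 * z +
          2 * (2 * n - 2 * k - O.card - 4)) ^ 2 -
        (4 + (if 2 * n - (k + 1) ∈ U.image Prod.snd then 2 else 1) ^ 2 + 8 * z ^ 2 +
          4 * (2 * n - 2 * k - O.card - 4)) + 8 * z * (z - 1)
      else 2 * ((if 2 * n - (k + 1) ∈ U.image Prod.snd then 2 else 1) + 4 * z +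
        2 * (2 * n - 2 * k - O.card - 4)) := by
  have hI : ∀ {x}, x ∈ O → k + 2 ≤ x ∧ x ≤ 2 * n - (k + 2) := fun hx =>
    Finset.mem_Icc.1 (hO hx)
  have hO' : O ⊆ Finset.Icc (k + 1) (2 * n - (k + 1)) := fun x hx => Finset.mem_Icc.2 (by
    have := hI hx
    omega)
  have hS := fun m : ℕ => (hU.sum_emptyRows (by omega) hO' hUO
    (fun r => rootWeight n (k + 1) (U.image Prod.snd) z r ^ m)).trans
      (sum_rootWeight_pow hk (U.image Prod.snd) hO hnO z m)
  have hS1 := hS 1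
  have hS2 := hS 2
  simp only [pow_one] at hS1
  have hane := hU.eq_iff_rootVal (by omega) ha (r := k + 1) le_rfl (by omega)
  have haO : a ∉ O := by
    intro h
    rw [rootVal_of_mem (mem_rootSet.2 (Or.inr (Finset.mem_Icc.1 (hO' h))))] at ha'
    have := hI h
    omega
  have hbO : b ∉ O := by
    intro h
    rw [rootVal_of_mem (mem_rootSet.2 (Or.inr (Finset.mem_Icc.1 (hO' h))))] at hb'
    exact hnO (hb' ▸ h)
  by_cases hj : k + 1 ∈ U.image Prod.snd
  · simp only [hj, true_or, Finset.filter_true, true_and, if_true] at hS1 hS2 ⊢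
    have hmem : ({a, b} : Finset ℕ) ∈ (emptyRows n U \ O).powersetCard 2 := by
      rw [Finset.mem_powersetCard, Finset.card_pair hab, Finset.insert_subset_iff,
        Finset.singleton_subset_iff, Finset.mem_sdiff, Finset.mem_sdiff]
      exact ⟨⟨⟨ha, haO⟩, hb, hbO⟩, rfl⟩
    have e1 : rootWeight n (k + 1) (U.image Prod.snd) z (k + 1) = 2 := by
      rw [rootWeight, if_neg (by tauto), if_neg (by omega), if_neg (by omega)]
      norm_num
    have e2 : rootWeight n (k + 1) (U.image Prod.snd) z n = 2 * z := by
      rw [rootWeight, if_neg (by omega), if_pos rfl, if_neg (by omega), mul_one]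
    have key : ∑ s ∈ (emptyRows n U \ O).powersetCard 2,
        (∏ i ∈ s, rootWeight n (k + 1) (U.image Prod.snd) z (rootVal (2 * n) (k + 1) U i)) *
          (if s = {a, b} then z else 1) =
        ∑ s ∈ (emptyRows n U \ O).powersetCard 2,
          (∏ i ∈ s, rootWeight n (k + 1) (U.image Prod.snd) z (rootVal (2 * n) (k + 1) U i)) +
          4 * z * (z - 1) := by
      rw [← Finset.add_sum_erase _ _ hmem, ← Finset.add_sum_erase _ _ hmem, if_pos rfl,
        Finset.sum_congr rfl fun s hs => by rw [if_neg (Finset.ne_of_mem_erase hs), mul_one],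
        Finset.prod_pair hab, ha', hb', e1, e2]
      ring
    rw [key, mul_add, two_mul_sum_pairs, hS1, hS2]
    ring
  · simp only [hj, false_or, false_and, if_false, mul_one] at hS1 hS2 ⊢
    have hak : a = k + 1 := hane.2 ⟨ha', hj⟩
    have e1 : rootWeight n (k + 1) (U.image Prod.snd) z (k + 1) = 1 := by
      rw [rootWeight, if_pos ⟨Or.inl rfl, hj⟩, if_neg (by omega), if_neg (by omega)]
      norm_num
    rw [hak] at ha ha' haO
    rw [sum_pairs_containing _ (Finset.mem_sdiff.2 ⟨ha, haO⟩), hS1, ha', e1]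
    ring

theorem two_pow_card_inter (hk : k + 2 ≤ n) (F : Finset ℕ) :
    (2 : ℚ) ^ (F ∩ Finset.Icc (k + 1) (2 * n - (k + 1))).card =
      2 ^ (F ∩ Finset.Icc (k + 2) (2 * n - (k + 2))).card *
        ((if k + 1 ∈ F then 2 else 1) * if 2 * n - (k + 1) ∈ F then 2 else 1) := by
  have hI : Finset.Icc (k + 1) (2 * n - (k + 1)) =
      insert (k + 1) (insert (2 * n - (k + 1)) (Finset.Icc (k + 2) (2 * n - (k + 2)))) := by
    ext x
    simp only [Finset.mem_insert, Finset.mem_Icc]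
    omega
  have h1 : 2 * n - (k + 1) ∉ F ∩ Finset.Icc (k + 2) (2 * n - (k + 2)) := by
    rw [Finset.mem_inter, Finset.mem_Icc]
    omega
  have h2 : k + 1 ∉ F ∩ Finset.Icc (k + 2) (2 * n - (k + 2)) := by
    rw [Finset.mem_inter, Finset.mem_Icc]
    omega
  have h3 : k + 1 ∉ insert (2 * n - (k + 1)) (F ∩ Finset.Icc (k + 2) (2 * n - (k + 2))) := by
    rw [Finset.mem_insert]
    rintro (h | h)
    · omega
    · exact h2 h
  rw [hI]
  by_cases hj : k + 1 ∈ F <;> by_cases hj' : 2 * n - (k + 1) ∈ F <;>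
    simp only [hj, hj', Finset.inter_insert_of_mem, Finset.inter_insert_of_notMem,
      Finset.card_insert_of_notMem h1, Finset.card_insert_of_notMem h2,
      Finset.card_insert_of_notMem h3, if_true, if_false, not_false_eq_true, pow_succ, mul_one,
      one_mul, mul_assoc]

/-- The polynomial function `x(2x - 1)`. -/
def quad (x : ℚ) : ℚ := x * (2 * x - 1)

theorem IsPartial.sum_nextColumns (hU : IsPartial n k U) (hk : k + 2 ≤ n) {O : Finset ℕ}
    (hO : O ⊆ Finset.Icc (k + 2) (2 * n - (k + 2))) (hnO : n ∉ O) (z M B : ℚ)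
    (hM : M = 2 * n - 2 * k - O.card - 4)
    (hB : B = M * (M - 1) / 2 + 2 * M * z + M + z + 2 * z ^ 2) :
    ∑ s ∈ nextColumns n (k + 1) U,
      2 ^ columnFree n (k + 1) s * z ^ columnMax n (k + 1) s (rootVal (2 * n) (k + 1) U) *
        2 ^ ((U.image Prod.snd ∪ s) ∩ Finset.Icc (k + 2) (2 * n - (k + 2))).card *
        (if Disjoint (U.image Prod.snd ∪ s) O then 1 else 0) =
      2 ^ (U.image Prod.snd ∩ Finset.Icc (k + 1) (2 * n - (k + 1))).card *
        (quad (z + M / 2 + 1) * (if Disjoint (U.image Prod.snd) O then 1 else 0) +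
          B * ((if Disjoint (U.image Prod.snd) (insert (2 * n - (k + 1)) O) then 1 else 0) -
            (if Disjoint (U.image Prod.snd) (insert (k + 1) O) then 1 else 0)) -
          quad (z + M / 2) *
            (if Disjoint (U.image Prod.snd) (insert (k + 1) (insert (2 * n - (k + 1)) O))
              then 1 else 0)) := by
  by_cases hUO : Disjoint (U.image Prod.snd) O
  · have hjr : k + 1 ∈ (emptyRows n U).image (rootVal (2 * n) (k + 1) U) := by
      rw [hU.image_rootVal (by omega), mem_rootSet]
      omega
    have hnr : n ∈ (emptyRows n U).image (rootVal (2 * n) (k + 1) U) := by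
      rw [hU.image_rootVal (by omega), mem_rootSet]
      omega
    obtain ⟨a, ha, ha'⟩ := Finset.mem_image.1 hjr
    obtain ⟨b, hb, hb'⟩ := Finset.mem_image.1 hnr
    have hab : a ≠ b := by
      rintro rfl
      omega
    have hfil : (nextColumns n (k + 1) U).filter (fun s => Disjoint (U.image Prod.snd ∪ s) O) =
        ((emptyRows n U \ O).powersetCard 2).filter
          (fun s => k + 1 ∈ U.image Prod.snd ∨ k + 1 ∈ s) := by
      ext s
      simp only [nextColumns, Finset.mem_filter, Finset.mem_powersetCard,
        Finset.disjoint_union_left, Finset.subset_sdiff]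
      tauto
    have key := hU.sum_nextColumns_disjoint hk hO hnO hUO z ha hb ha' hb' hab
    rw [← hM] at key
    simp only [mul_ite, mul_one, mul_zero]
    rw [← Finset.sum_filter, hfil, Finset.sum_congr rfl fun s hs => by
      obtain ⟨hs, -⟩ := Finset.mem_filter.1 hs
      obtain ⟨hs, hc⟩ := Finset.mem_powersetCard.1 hs
      exact hU.weight_eq (by omega) (hs.trans Finset.sdiff_subset) hc ha hb ha' hb' hab z,
      ← Finset.mul_sum, two_pow_card_inter hk, mul_assoc]
    congr 1
    simp only [Finset.disjoint_insert_right, hUO, and_true]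
    rw [← mul_right_inj' (two_ne_zero : (2 : ℚ) ≠ 0), key, quad, quad, hB]
    by_cases hj : k + 1 ∈ U.image Prod.snd <;>
    by_cases hj' : 2 * n - (k + 1) ∈ U.image Prod.snd <;>
    simp only [hj, hj', if_true, if_false, not_true_eq_false, not_false_eq_true, and_true,
      and_false, and_self] <;>
    ring
  · simp [Finset.disjoint_insert_right, Finset.disjoint_union_left, hUO]

/-- The weighted count of partial configurations with `k` columns missing the rows `O`. -/
noncomputable def partialSum (n k : ℕ) (O : Finset ℕ) (z : ℚ) : ℚ :=
  ∑ U ∈ partials n k,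
    (∏ i ∈ Finset.Icc 1 k, 2 ^ columnFree n i (columnRows U i) *
        z ^ columnMax n i (columnRows U i) (rootVal (2 * n) i U)) *
      (2 ^ (U.image Prod.snd ∩ Finset.Icc (k + 1) (2 * n - (k + 1))).card *
        if Disjoint (U.image Prod.snd) O then 1 else 0)

/-- The evaluation of `partialSum`, as a function of `z + (2(n - 1 - k) - |O|) / 2`. -/
noncomputable def zeta : ℕ → ℚ → ℚ
  | 0, _ => 1
  | k + 1, y => quad (y + 1) * zeta k (y + 1) - quad y * zeta k y

theorem prod_addColumn (hU : IsPartial n k U) (hk : k + 1 ≤ 2 * n) (s : Finset ℕ) (z : ℚ) :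
    ∏ i ∈ Finset.Icc 1 (k + 1), (2 : ℚ) ^ columnFree n i (columnRows (addColumn U (k + 1) s) i) *
        z ^ columnMax n i (columnRows (addColumn U (k + 1) s) i)
          (rootVal (2 * n) i (addColumn U (k + 1) s)) =
      (∏ i ∈ Finset.Icc 1 k, 2 ^ columnFree n i (columnRows U i) *
        z ^ columnMax n i (columnRows U i) (rootVal (2 * n) i U)) *
      (2 ^ columnFree n (k + 1) s *
        z ^ columnMax n (k + 1) s (rootVal (2 * n) (k + 1) U)) := by
  rw [Finset.prod_Icc_succ_top (by omega), hU.columnRows_addColumn, rootVal_addColumn le_rfl hk]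
  congr 1
  refine Finset.prod_congr rfl fun i hi => ?_
  have := Finset.mem_Icc.1 hi
  rw [columnRows_addColumn_of_ne (by omega), rootVal_addColumn (by omega) hk]

theorem partialSum_succ (hk : k + 2 ≤ n) {O : Finset ℕ}
    (hO : O ⊆ Finset.Icc (k + 2) (2 * n - (k + 2))) (hnO : n ∉ O) (z M B : ℚ)
    (hM : M = 2 * n - 2 * k - O.card - 4)
    (hB : B = M * (M - 1) / 2 + 2 * M * z + M + z + 2 * z ^ 2) :
    partialSum n (k + 1) O z =
      quad (z + M / 2 + 1) * partialSum n k O z +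
        B * (partialSum n k (insert (2 * n - (k + 1)) O) z -
          partialSum n k (insert (k + 1) O) z) -
        quad (z + M / 2) * partialSum n k (insert (k + 1) (insert (2 * n - (k + 1)) O)) z := by
  simp only [partialSum]
  rw [sum_partials_succ, ← Finset.sum_sub_distrib, Finset.mul_sum, Finset.mul_sum, Finset.mul_sum,
    ← Finset.sum_add_distrib, ← Finset.sum_sub_distrib]
  refine Finset.sum_congr rfl fun U hU => ?_
  rw [mem_partials] at hU
  have key := hU.sum_nextColumns hk hO hnO z M B hM hB
  simp only [prod_addColumn hU (show k + 1 ≤ 2 * n by omega), image_snd_addColumn, mul_assoc,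
    ← Finset.mul_sum]
  simp only [mul_assoc] at key
  rw [key]
  ring

theorem partialSum_eq (hk : k + 1 ≤ n) {O : Finset ℕ}
    (hO : O ⊆ Finset.Icc (k + 1) (2 * n - (k + 1))) (hnO : n ∉ O) (z : ℚ) :
    partialSum n k O z = zeta k (z + (2 * n - 2 - 2 * k - O.card) / 2) := by
  induction k generalizing O with
  | zero =>
    have h : partials n 0 = {∅} := by
      ext U
      rw [mem_partials, Finset.mem_singleton]
      constructor
      · intro hU
        exact Finset.card_eq_zero.1 hU.card_eq
      · rintro rfl
        exact ⟨by simp, by simp, fun j h1 hj => by omega, fun i h1 hi => by omega⟩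
    simp [partialSum, h, zeta]
  | succ k ih =>
    have hI : ∀ {x}, x ∈ O → k + 2 ≤ x ∧ x ≤ 2 * n - (k + 2) := fun hx =>
      Finset.mem_Icc.1 (hO hx)
    have h1 : k + 1 ∉ O := fun h => by
      have := hI h
      omega
    have h2 : 2 * n - (k + 1) ∉ O := fun h => by
      have := hI h
      omega
    have hO' : O ⊆ Finset.Icc (k + 1) (2 * n - (k + 1)) := fun x hx => Finset.mem_Icc.2 (by
      have := hI hx
      omega)
    have h3 : k + 1 ∉ insert (2 * n - (k + 1)) O := by
      rw [Finset.mem_insert, not_or]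
      exact ⟨by omega, h1⟩
    have m1 : k + 1 ∈ Finset.Icc (k + 1) (2 * n - (k + 1)) := Finset.mem_Icc.2 (by omega)
    have m2 : 2 * n - (k + 1) ∈ Finset.Icc (k + 1) (2 * n - (k + 1)) :=
      Finset.mem_Icc.2 (by omega)
    have n2 : n ∉ insert (2 * n - (k + 1)) O := by
      rw [Finset.mem_insert, not_or]
      exact ⟨by omega, hnO⟩
    have n1 : ∀ {O'}, n ∉ O' → n ∉ insert (k + 1) O' := fun h => by
      rw [Finset.mem_insert, not_or]
      exact ⟨by omega, h⟩
    rw [partialSum_succ hk hO hnO z _ _ rfl rfl, ih (by omega) hO' hnO,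
      ih (by omega) (Finset.insert_subset m2 hO') n2,
      ih (by omega) (Finset.insert_subset m1 hO') (n1 hnO),
      ih (by omega) (Finset.insert_subset m1 (Finset.insert_subset m2 hO')) (n1 n2),
      Finset.card_insert_of_notMem h1, Finset.card_insert_of_notMem h3,
      Finset.card_insert_of_notMem h2, sub_self, mul_zero, add_zero, zeta]
    push_cast
    congr 3 <;> ring_nf

/-! ### The last column -/

theorem IsPartial.nextColumns_last (hU : IsPartial (n + 1) n U) :
    nextColumns (n + 1) (n + 1) U = {emptyRows (n + 1) U} := by
  have hcard : (emptyRows (n + 1) U).card = 2 := by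
    rw [hU.card_emptyRows]
    omega
  rw [nextColumns, ← hcard, Finset.powersetCard_self, Finset.filter_singleton, if_pos]
  rw [emptyRows, Finset.mem_sdiff, Finset.mem_Icc]
  by_cases h : n + 1 ∈ U.image Prod.snd
  · exact Or.inl h
  · exact Or.inr ⟨by omega, h⟩

theorem IsPartial.columnFree_last (hU : IsPartial (n + 1) n U) :
    columnFree (n + 1) (n + 1) (emptyRows (n + 1) U) =
      1 + (U.image Prod.snd ∩ Finset.Icc (n + 1) (2 * (n + 1) - (n + 1))).card := by
  have hcard : (emptyRows (n + 1) U).card = 2 := by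
    rw [hU.card_emptyRows]
    omega
  have hmem : n + 1 ∈ emptyRows (n + 1) U ↔ n + 1 ∉ U.image Prod.snd := by
    rw [emptyRows, Finset.mem_sdiff, Finset.mem_Icc, and_iff_right (by omega)]
  have hfil : (emptyRows (n + 1) U).filter (fun i => 2 * (n + 1) + 1 ≤ i + (n + 1)) =
      (emptyRows (n + 1) U).erase (n + 1) := by
    ext i
    rw [Finset.mem_filter, Finset.mem_erase, and_comm]
    refine and_congr_left fun hi => ?_
    have := hU.lt_of_mem_emptyRows hi
    omega
  rw [columnFree, hfil, show 2 * (n + 1) - (n + 1) = n + 1 by omega, Finset.Icc_self]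
  by_cases h : n + 1 ∈ U.image Prod.snd
  · rw [Finset.erase_eq_of_notMem (by rwa [hmem, not_not]), hcard,
      Finset.inter_singleton_of_mem h, Finset.card_singleton]
  · rw [Finset.card_erase_of_mem (hmem.2 h), hcard, Finset.inter_singleton_of_notMem h,
      Finset.card_empty]

theorem sum_tneF (n : ℕ) (z : ℚ) :
    ∑ T ∈ TneF (n + 1), 2 ^ (frE (n + 1) T - 1) * z ^ maxStat (n + 1) T = zeta n z := by
  have h := partialSum_eq (n := n + 1) (k := n) le_rfl (Finset.empty_subset _)
    (Finset.notMem_empty _) z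
  rw [show z + (2 * ((n + 1 : ℕ) : ℚ) - 2 - 2 * n - (∅ : Finset ℕ).card) / 2 = z by
    push_cast [Finset.card_empty]
    ring] at h
  rw [← h, tneF_eq_partials, sum_partials_succ, partialSum]
  refine Finset.sum_congr rfl fun U hU => ?_
  rw [mem_partials] at hU
  have hs : emptyRows (n + 1) U ∈ nextColumns (n + 1) (n + 1) U := by
    rw [hU.nextColumns_last]
    exact Finset.mem_singleton_self _
  have hT := hU.addColumn hs
  have hcol : ∀ i ∈ Finset.Icc 1 n,
      columnRows (addColumn U (n + 1) (emptyRows (n + 1) U)) i = columnRows U i := fun i hi => by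
    have := Finset.mem_Icc.1 hi
    exact columnRows_addColumn_of_ne (by omega) _
  have hfr : frE (n + 1) (addColumn U (n + 1) (emptyRows (n + 1) U)) - 1 =
      ∑ i ∈ Finset.Icc 1 n, columnFree (n + 1) i (columnRows U i) +
        (U.image Prod.snd ∩ Finset.Icc (n + 1) (2 * (n + 1) - (n + 1))).card := by
    rw [hT.frE_eq, Finset.sum_Icc_succ_top (by omega), hU.columnRows_addColumn,
      hU.columnFree_last, Finset.sum_congr rfl fun i hi => by rw [hcol i hi]]
    omega
  have hmax : maxStat (n + 1) (addColumn U (n + 1) (emptyRows (n + 1) U)) =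
      ∑ i ∈ Finset.Icc 1 n, columnMax (n + 1) i (columnRows U i) (rootVal (2 * (n + 1)) i U) := by
    rw [hT.maxStat_eq (by omega), Nat.add_sub_cancel]
    refine Finset.sum_congr rfl fun i hi => ?_
    have := Finset.mem_Icc.1 hi
    rw [hcol i hi, rootVal_addColumn (by omega) (by omega)]
  rw [hU.nextColumns_last, Finset.sum_singleton, hfr, hmax, if_pos (Finset.disjoint_empty_right _),
    Finset.prod_mul_distrib, Finset.prod_pow_eq_pow_sum, Finset.prod_pow_eq_pow_sum, pow_add]
  ring

/-! ### The generating polynomial -/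

/-- The generating polynomial of the numbers `eStat n k`. -/
noncomputable def ePoly (n : ℕ) : Polynomial ℚ :=
  ∑ T ∈ TneF n, Polynomial.monomial (maxStat n T) (2 ^ (frE n T - 1 - maxStat n T))

theorem coeff_ePoly (n k : ℕ) : (ePoly n).coeff k = eStat n k := by
  rw [ePoly, Polynomial.finsetSum_coeff, eStat, Finset.sum_filter]
  push_cast
  refine Finset.sum_congr rfl fun T _ => ?_
  rw [Polynomial.coeff_monomial]
  split_ifs with h
  · rw [h]
  · rfl

theorem eval_ePoly (n : ℕ) (x : ℚ) : (ePoly (n + 1)).eval x = zeta n (x / 2) := by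
  rw [← sum_tneF, ePoly, Polynomial.eval_finsetSum]
  refine Finset.sum_congr rfl fun T hT => ?_
  rw [tneF_eq_partials, mem_partials] at hT
  have := hT.maxStat_lt (by omega)
  rw [Polynomial.eval_monomial, div_pow, ← Nat.sub_add_cancel (Nat.le_sub_one_of_lt this), pow_add,
    Nat.add_sub_cancel]
  field_simp

theorem ePoly_one : ePoly 1 = 1 := by
  refine Polynomial.funext fun x => ?_
  rw [eval_ePoly, zeta, Polynomial.eval_one]

theorem ePoly_succ (n : ℕ) :
    ePoly (n + 2) = Polynomial.C (1/2 : ℚ) *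
        ((Polynomial.X + 2) * (Polynomial.X + 1) * ((ePoly (n+1)).comp (Polynomial.X + 2))
          - Polynomial.X * (Polynomial.X - 1) * (ePoly (n+1))) := by
  refine Polynomial.funext fun x => ?_
  simp only [Polynomial.eval_mul, Polynomial.eval_C, Polynomial.eval_sub, Polynomial.eval_add,
    Polynomial.eval_X, Polynomial.eval_one, Polynomial.eval_comp, Polynomial.eval_ofNat, eval_ePoly,
    zeta, quad]
  rw [show x / 2 + 1 = (x + 2) / 2 by ring]
  ring

/-- The coefficient of `e_{n-1,i}` in the recurrence for `e_{n,k}`. -/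
def stepCoeff (i k : ℕ) : ℕ :=
  if k = 0 then 2 ^ i
  else if k ≤ i then 2 ^ (i - k) * ((i + 1).choose k + 2 * (i + 1).choose (k - 1))
  else if k = i + 1 then i + 2
  else 0

theorem coeff_step (i k : ℕ) :
    (Polynomial.C (1/2 : ℚ) *
      ((Polynomial.X + 2) * (Polynomial.X + 1) * (Polynomial.X ^ i).comp (Polynomial.X + 2)
          - Polynomial.X * (Polynomial.X - 1) * Polynomial.X ^ i)).coeff k =
      (stepCoeff i k : ℚ) := by
  have h : (Polynomial.X + 2) * (Polynomial.X + 1) * (Polynomial.X ^ i).comp (Polynomial.X + 2)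
          - Polynomial.X * (Polynomial.X - 1) * Polynomial.X ^ i =
      (Polynomial.X + Polynomial.C (2 : ℚ)) ^ (i + 1) * Polynomial.X +
        (Polynomial.X + Polynomial.C (2 : ℚ)) ^ (i + 1) - Polynomial.X ^ (i + 2) +
        Polynomial.X ^ (i + 1) := by
    rw [Polynomial.X_pow_comp, Polynomial.C_ofNat]
    ring
  rw [h, Polynomial.coeff_C_mul, Polynomial.coeff_add, Polynomial.coeff_sub, Polynomial.coeff_add,
    Polynomial.coeff_X_pow, Polynomial.coeff_X_pow, Polynomial.coeff_X_add_C_pow]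
  cases k with
  | zero =>
    rw [Polynomial.coeff_mul_X_zero, stepCoeff, if_pos rfl, if_neg (by omega), if_neg (by omega)]
    push_cast [Nat.choose_zero_right]
    ring
  | succ k =>
    rw [Polynomial.coeff_mul_X, Polynomial.coeff_X_add_C_pow, stepCoeff,
      if_neg (Nat.succ_ne_zero k)]
    rcases lt_trichotomy k i with hk | rfl | hk
    · rw [if_neg (show ¬ k + 1 = i + 2 by omega), if_neg (show ¬ k + 1 = i + 1 by omega),
        if_pos (show k + 1 ≤ i by omega), show i + 1 - k = (i - (k + 1)) + 2 by omega,
        show i + 1 - (k + 1) = (i - (k + 1)) + 1 by omega, Nat.add_sub_cancel]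
      push_cast
      ring
    · rw [if_neg (show ¬ k + 1 = k + 2 by omega), if_pos rfl,
        if_neg (show ¬ k + 1 ≤ k by omega), if_pos rfl, Nat.choose_self,
        Nat.choose_succ_self_right, Nat.sub_self, Nat.add_sub_cancel_left]
      push_cast
      ring
    · rw [if_neg (show ¬ k + 1 = i + 1 by omega), if_neg (show ¬ k + 1 ≤ i by omega),
        if_neg (show ¬ k + 1 = i + 1 by omega),
        Nat.choose_eq_zero_of_lt (show i + 1 < k + 1 by omega)]
      by_cases hk' : k = i + 1
      · subst hk'
        rw [if_pos rfl, Nat.choose_self]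
        simp
      · rw [if_neg (show ¬ k + 1 = i + 2 by omega),
          Nat.choose_eq_zero_of_lt (show i + 1 < k by omega)]
        simp

theorem eStat_succ_of_vanish (hv : ∀ k, n + 1 ≤ k → eStat (n + 1) k = 0) (k : ℕ) :
    eStat (n + 2) k = ∑ i ∈ Finset.range (n + 1), stepCoeff i k * eStat (n + 1) i := by
  have hp : ePoly (n + 1) = ∑ i ∈ Finset.range (n + 1),
      Polynomial.C (eStat (n + 1) i : ℚ) * Polynomial.X ^ i := by
    ext k
    simp only [coeff_ePoly, Polynomial.finsetSum_coeff, Polynomial.coeff_C_mul_X_pow,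
      Finset.sum_ite_eq, Finset.mem_range]
    split_ifs with h
    · rfl
    · rw [hv k (by omega), Nat.cast_zero]
  have h := coeff_ePoly (n + 2) k
  have e : ePoly (n + 2) = ∑ i ∈ Finset.range (n + 1), Polynomial.C (eStat (n + 1) i : ℚ) *
      (Polynomial.C (1/2 : ℚ) *
      ((Polynomial.X + 2) * (Polynomial.X + 1) * (Polynomial.X ^ i).comp (Polynomial.X + 2)
          - Polynomial.X * (Polynomial.X - 1) * Polynomial.X ^ i)) := by
    rw [ePoly_succ, hp, Polynomial.sum_comp, Finset.mul_sum, Finset.mul_sum,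
      ← Finset.sum_sub_distrib, Finset.mul_sum]
    refine Finset.sum_congr rfl fun i _ => ?_
    rw [Polynomial.mul_comp, Polynomial.C_comp]
    ring
  rw [e, Polynomial.finsetSum_coeff] at h
  rw [Finset.sum_congr rfl fun i _ => by
    rw [Polynomial.coeff_C_mul, coeff_step, mul_comm]] at h
  exact_mod_cast h.symm

theorem eStat_eq_zero (hk : n + 1 ≤ k) : eStat (n + 1) k = 0 := by
  induction n generalizing k with
  | zero =>
    have h := coeff_ePoly 1 k
    rw [ePoly_one, Polynomial.coeff_one, if_neg (by omega)] at h
    exact_mod_cast h.symm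
  | succ n ih =>
    rw [eStat_succ_of_vanish fun k hk => ih hk]
    refine Finset.sum_eq_zero fun i hi => ?_
    have := Finset.mem_range.1 hi
    rw [stepCoeff, if_neg (by omega), if_neg (by omega), if_neg (by omega), zero_mul]

theorem eStat_succ (n k : ℕ) :
    eStat (n + 2) k = ∑ i ∈ Finset.range (n + 1), stepCoeff i k * eStat (n + 1) i :=
  eStat_succ_of_vanish (fun _ => eStat_eq_zero) k

end

/-- The numbers `e_{n,k}` satisfy the induction formulas (1), (2), (3). -/
theorem statement18 (n : ℕ) (hn : 2 ≤ n) :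
    (eStat n 0 = ∑ i ∈ Finset.range (n-1), 2 ^ i * eStat (n-1) i) ∧
    (∀ k : ℕ, 1 ≤ k → k ≤ n - 2 →
      eStat n k = (k + 1) * eStat (n-1) (k-1) +
        ∑ i ∈ Finset.Icc k (n-2),
          2 ^ (i - k) * ((i+1).choose k + 2 * (i+1).choose (k-1)) * eStat (n-1) i) ∧
    eStat n (n-1) = n * eStat (n-1) (n-2) := by
  obtain ⟨m, rfl⟩ := Nat.exists_eq_add_of_le' hn
  rw [show m + 2 - 1 = m + 1 by omega, show m + 2 - 2 = m by omega]
  simp only [eStat_succ m]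
  refine ⟨Finset.sum_congr rfl fun i _ => by rw [stepCoeff, if_pos rfl], fun k h1 hk => ?_, ?_⟩
  · have hdecomp : Finset.range (m + 1) =
        Finset.range (k - 1) ∪ insert (k - 1) (Finset.Icc k m) := by
      ext i
      simp only [Finset.mem_union, Finset.mem_insert, Finset.mem_range, Finset.mem_Icc]
      omega
    rw [hdecomp, Finset.sum_union, Finset.sum_insert, Finset.sum_eq_zero, zero_add]
    · congr 1
      · rw [stepCoeff, if_neg (by omega), if_neg (by omega), if_pos (by omega),
          show k - 1 + 2 = k + 1 by omega]
      · refine Finset.sum_congr rfl fun i hi => ?_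
        rw [stepCoeff, if_neg (by omega), if_pos (Finset.mem_Icc.1 hi).1]
    · intro i hi
      have := Finset.mem_range.1 hi
      rw [stepCoeff, if_neg (by omega), if_neg (by omega), if_neg (by omega), zero_mul]
    · rw [Finset.mem_Icc]
      omega
    · rw [Finset.disjoint_left]
      intro i
      simp only [Finset.mem_insert, Finset.mem_range, Finset.mem_Icc]
      omega
  · rw [Finset.sum_range_succ, Finset.sum_eq_zero, zero_add, stepCoeff, if_neg (by omega),
      if_neg (by omega), if_pos rfl]
    intro i hi
    have := Finset.mem_range.1 hi
    rw [stepCoeff, if_neg (by omega), if_neg (by omega), if_neg (by omega), zero_mul]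

end SymDellac
end

section
/- For every integer n ≥ 1, the polynomial identity P_n(x) = Σ_{f ∈ SP_n} 2^{n − 1 − max(f) − fd(f)} · x^{max(f)} holds (in particular max(f) + fd(f) ≤ n − 1 for every surjective pistol f of size n). -/
open scoped Classical

namespace SymDellac

/-! ### Building pistols of size `n + 1` from pistols of size `n` -/

/-- The positions at which `f` takes its largest possible value. -/
def topSet (n : ℕ) (f : Fin (2*n) → Fin (2*n)) : Finset (Fin (2*n)) :=
  Finset.univ.filter (fun k => (f k : ℕ) + 1 = 2*n)

/-- Extend `f` by two positions, sending these and the positions in `S` to the new top value. -/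
noncomputable def raise (n : ℕ) (f : Fin (2*n) → Fin (2*n)) (S : Finset (Fin (2*n))) :
    Fin (2*(n+1)) → Fin (2*(n+1)) := fun k =>
  if h : (k : ℕ) < 2*n then
    if (⟨k, h⟩ : Fin (2*n)) ∈ S then ⟨2*n+1, by omega⟩ else ⟨f ⟨k, h⟩, by omega⟩
  else ⟨2*n+1, by omega⟩

/-- Forget the last two positions and identify the two largest values. -/
def lower (n : ℕ) (g : Fin (2*(n+1)) → Fin (2*(n+1))) : Fin (2*n) → Fin (2*n) := fun k =>
  ⟨min (g ⟨k, by omega⟩ : Fin (2*(n+1))).val (2*n-1),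
    lt_of_le_of_lt (min_le_right _ _) (by have := k.isLt; omega)⟩

/-- The old positions at which `g` takes the new top value. -/
def raisedSet (n : ℕ) (g : Fin (2*(n+1)) → Fin (2*(n+1))) : Finset (Fin (2*n)) :=
  Finset.univ.filter (fun k => (g ⟨k, by omega⟩ : ℕ) = 2*n+1)

lemma mem_SPF {n : ℕ} {f : Fin (2*n) → Fin (2*n)} : f ∈ SPF n ↔ IsSP n f := by
  simp [SPF]

lemma mem_topSet {n : ℕ} {f : Fin (2*n) → Fin (2*n)} {k : Fin (2*n)} :
    k ∈ topSet n f ↔ (f k : ℕ) + 1 = 2*n := by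
  simp [topSet]

lemma mem_raisedSet {n : ℕ} {g : Fin (2*(n+1)) → Fin (2*(n+1))} {k : Fin (2*n)} :
    k ∈ raisedSet n g ↔ (g ⟨k, by omega⟩ : ℕ) = 2*n+1 := by
  simp [raisedSet]

lemma raise_val_of_mem {n : ℕ} (f : Fin (2*n) → Fin (2*n)) {S : Finset (Fin (2*n))}
    {k : Fin (2*n)} (hk : k ∈ S) : (raise n f S ⟨k, by omega⟩ : ℕ) = 2*n+1 := by
  simp [raise, hk]

lemma raise_val_of_notMem {n : ℕ} (f : Fin (2*n) → Fin (2*n)) {S : Finset (Fin (2*n))}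
    {k : Fin (2*n)} (hk : k ∉ S) : (raise n f S ⟨k, by omega⟩ : ℕ) = f k := by
  simp [raise, hk]

lemma raise_val_of_le {n : ℕ} (f : Fin (2*n) → Fin (2*n)) (S : Finset (Fin (2*n)))
    {k : Fin (2*(n+1))} (hk : 2*n ≤ (k : ℕ)) : (raise n f S k : ℕ) = 2*n+1 := by
  simp [raise, hk.not_gt]

lemma isSP_raise {n : ℕ} {f : Fin (2*n) → Fin (2*n)} (hf : IsSP n f)
    {S : Finset (Fin (2*n))} (hS : S ⊂ topSet n f) : IsSP (n+1) (raise n f S) := by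
  constructor
  · intro k
    by_cases hk : (k : ℕ) < 2*n
    · by_cases hkS : (⟨k, hk⟩ : Fin (2*n)) ∈ S
      · have := raise_val_of_mem f hkS
        simp only [Fin.eta] at this
        rw [this]
        exact ⟨⟨n+1, by ring⟩, by omega⟩
      · have := raise_val_of_notMem f hkS
        simp only [Fin.eta] at this
        rw [this]
        exact hf.1 ⟨k, hk⟩
    · rw [raise_val_of_le f S (by omega)]
      exact ⟨⟨n+1, by ring⟩, by omega⟩
  · intro m hm
    by_cases hm' : (m : ℕ) < 2*n
    · by_cases hm1 : (m : ℕ) + 1 = 2*n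
      · obtain ⟨k, hk, hkS⟩ := Finset.exists_of_ssubset hS
        refine ⟨⟨k, by omega⟩, Fin.ext ?_⟩
        rw [raise_val_of_notMem f hkS]
        rw [mem_topSet] at hk
        omega
      · obtain ⟨k, hk⟩ := hf.2 ⟨m, hm'⟩ hm
        have hkm : (f k : ℕ) = m := by rw [hk]
        refine ⟨⟨k, by omega⟩, Fin.ext ?_⟩
        rw [raise_val_of_notMem f, hkm]
        intro h
        have := mem_topSet.1 (hS.1 h)
        omega
    · refine ⟨⟨2*n, by omega⟩, Fin.ext ?_⟩
      rw [raise_val_of_le f S (by simp)]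
      have := Nat.even_iff.1 hm
      omega

lemma raisedSet_raise {n : ℕ} (f : Fin (2*n) → Fin (2*n)) (S : Finset (Fin (2*n))) :
    raisedSet n (raise n f S) = S := by
  ext k
  rw [mem_raisedSet]
  by_cases hk : k ∈ S
  · simp [raise_val_of_mem f hk, hk]
  · rw [raise_val_of_notMem f hk]
    simp only [hk, iff_false]
    omega

lemma lower_raise {n : ℕ} {f : Fin (2*n) → Fin (2*n)} {S : Finset (Fin (2*n))}
    (hS : S ⊆ topSet n f) : lower n (raise n f S) = f := by
  funext k
  apply Fin.ext
  by_cases hk : k ∈ S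
  · have := mem_topSet.1 (hS hk)
    simp only [lower, raise_val_of_mem f hk]
    omega
  · simp only [lower, raise_val_of_notMem f hk]
    omega

lemma IsSP.val_eq_or_lt {n : ℕ} {g : Fin (2*(n+1)) → Fin (2*(n+1))} (hg : IsSP (n+1) g)
    (k : Fin (2*(n+1))) : (g k : ℕ) = 2*n+1 ∨ (g k : ℕ) < 2*n := by
  have := Nat.even_iff.1 (hg.1 k).1
  omega

lemma raise_lower {n : ℕ} {g : Fin (2*(n+1)) → Fin (2*(n+1))} (hg : IsSP (n+1) g) :
    raise n (lower n g) (raisedSet n g) = g := by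
  funext k
  apply Fin.ext
  have hk' := hg.val_eq_or_lt k
  by_cases hk : (k : ℕ) < 2*n
  · by_cases hkS : (⟨k, hk⟩ : Fin (2*n)) ∈ raisedSet n g
    · have := raise_val_of_mem (lower n g) hkS
      simp only [Fin.eta] at this
      rw [this]
      exact (mem_raisedSet.1 hkS).symm
    · have := raise_val_of_notMem (lower n g) hkS
      simp only [Fin.eta] at this
      rw [this]
      rw [mem_raisedSet] at hkS
      simp only [lower, Fin.eta] at hkS ⊢
      omega
  · rw [raise_val_of_le _ _ (by omega)]
    have := (hg.1 k).2
    omega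

lemma isSP_lower {n : ℕ} {g : Fin (2*(n+1)) → Fin (2*(n+1))} (hg : IsSP (n+1) g) :
    IsSP n (lower n g) := by
  constructor
  · intro k
    have h1 := hg.1 ⟨k, by omega⟩
    have h2 := hg.val_eq_or_lt ⟨k, by omega⟩
    rw [Nat.even_iff] at h1 ⊢
    simp only [lower] at h1 h2 ⊢
    omega
  · intro m hm
    obtain ⟨k, hk⟩ := hg.2 ⟨m, by omega⟩ hm
    have h1 := (hg.1 k).2
    have h2 : (g k : ℕ) = m := by rw [hk]
    refine ⟨⟨k, by omega⟩, Fin.ext ?_⟩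
    simp only [lower, Fin.eta]
    omega

lemma raisedSet_ssubset {n : ℕ} (hn : 1 ≤ n) {g : Fin (2*(n+1)) → Fin (2*(n+1))}
    (hg : IsSP (n+1) g) : raisedSet n g ⊂ topSet n (lower n g) := by
  rw [Finset.ssubset_iff_of_subset]
  · obtain ⟨k, hk⟩ := hg.2 ⟨2*n-1, by omega⟩ ⟨n, by simp only; omega⟩
    have h1 := (hg.1 k).2
    have h2 : (g k : ℕ) = 2*n-1 := by rw [hk]
    refine ⟨⟨k, by omega⟩, ?_, ?_⟩
    · rw [mem_topSet]
      simp only [lower, Fin.eta]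
      omega
    · rw [mem_raisedSet]
      simp only [Fin.eta]
      omega
  · intro k hk
    rw [mem_raisedSet] at hk
    rw [mem_topSet]
    simp only [lower]
    omega

lemma exists_raise {n : ℕ} (hn : 1 ≤ n) {g : Fin (2*(n+1)) → Fin (2*(n+1))}
    (hg : g ∈ SPF (n+1)) : ∃ f ∈ SPF n, ∃ S ⊂ topSet n f, raise n f S = g := by
  rw [mem_SPF] at hg
  exact ⟨lower n g, mem_SPF.2 (isSP_lower hg), raisedSet n g, raisedSet_ssubset hn hg,
    raise_lower hg⟩

lemma sum_SPF_succ {M : Type*} [AddCommMonoid M] {n : ℕ} (hn : 1 ≤ n)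
    (F : (Fin (2*(n+1)) → Fin (2*(n+1))) → M) :
    ∑ g ∈ SPF (n+1), F g = ∑ f ∈ SPF n, ∑ S ∈ (topSet n f).ssubsets, F (raise n f S) := by
  rw [Finset.sum_sigma' (SPF n) (fun f => (topSet n f).ssubsets)
    (fun f S => F (raise n f S))]
  symm
  refine Finset.sum_bij' (fun x _ => raise n x.1 x.2)
    (fun g _ => ⟨lower n g, raisedSet n g⟩) ?_ ?_ ?_ ?_ ?_
  · rintro ⟨f, S⟩ h
    rw [Finset.mem_sigma, Finset.mem_ssubsets, mem_SPF] at h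
    exact mem_SPF.2 (isSP_raise h.1 h.2)
  · intro g hg
    rw [mem_SPF] at hg
    rw [Finset.mem_sigma, Finset.mem_ssubsets, mem_SPF]
    exact ⟨isSP_lower hg, raisedSet_ssubset hn hg⟩
  · rintro ⟨f, S⟩ h
    rw [Finset.mem_sigma, Finset.mem_ssubsets, mem_SPF] at h
    simp only [raisedSet_raise, lower_raise h.2.1]
  · intro g hg
    exact raise_lower (mem_SPF.1 hg)
  · intros
    rfl

/-! ### Effect on the statistics -/

lemma card_filter_of_forall_lt {n : ℕ} (p : Fin (2*(n+1)) → Prop) [DecidablePred p]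
    (hp : ∀ k, p k → (k : ℕ) < 2*n) :
    (Finset.univ.filter p).card =
      (Finset.univ.filter (fun k : Fin (2*n) => p ⟨k, by omega⟩)).card := by
  symm
  refine Finset.card_bij (fun k _ => ⟨k, by omega⟩) ?_ ?_ ?_
  · intro k hk
    simpa using hk
  · intro k _ l _ h
    exact Fin.ext (Fin.mk.inj_iff.1 h)
  · intro k hk
    rw [Finset.mem_filter] at hk
    exact ⟨⟨k, hp k hk.2⟩, by simpa using hk, rfl⟩

lemma maxP_raise {n : ℕ} (f : Fin (2*n) → Fin (2*n)) (S : Finset (Fin (2*n))) :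
    maxP (n+1) (raise n f S) = S.card := by
  rw [maxP, card_filter_of_forall_lt _ (fun k hk => by omega)]
  congr 1
  conv_rhs => rw [← raisedSet_raise f S]
  ext k
  rw [mem_raisedSet, Finset.mem_filter]
  simp only [Finset.mem_univ, true_and]
  omega

/-- The last position of a pistol. -/
def lastPos (n : ℕ) (hn : 1 ≤ n) : Fin (2*n) := ⟨2*n-1, by omega⟩

lemma lastPos_mem_topSet {n : ℕ} (hn : 1 ≤ n) {f : Fin (2*n) → Fin (2*n)} (hf : IsSP n f) :
    lastPos n hn ∈ topSet n f := by
  have := (hf.1 (lastPos n hn)).2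
  simp only [lastPos] at this
  rw [mem_topSet, lastPos]
  omega

lemma card_topSet {n : ℕ} (hn : 1 ≤ n) {f : Fin (2*n) → Fin (2*n)} (hf : IsSP n f) :
    (topSet n f).card = maxP n f + 2 := by
  obtain ⟨m, rfl⟩ : ∃ m, n = m + 1 := ⟨n - 1, by omega⟩
  have h : topSet (m+1) f =
      insert (⟨2*m, by omega⟩ : Fin (2*(m+1))) (insert (⟨2*m+1, by omega⟩ : Fin (2*(m+1)))
        (Finset.univ.filter (fun k : Fin (2*(m+1)) =>
          (k : ℕ) + 1 ≤ 2*(m+1) - 2 ∧ (f k : ℕ) + 1 = 2*(m+1)))) := by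
    ext k
    have h1 := hf.val_eq_or_lt k
    have h2 := (hf.1 k).2
    simp only [mem_topSet, Finset.mem_insert, Finset.mem_filter, Finset.mem_univ, true_and,
      Fin.ext_iff]
    omega
  rw [h, Finset.card_insert_of_notMem, Finset.card_insert_of_notMem, maxP]
  · simp only [Finset.mem_filter]
    omega
  · simp only [Finset.mem_insert, Finset.mem_filter, Fin.mk.injEq]
    omega

lemma fdP_raise {n : ℕ} (hn : 1 ≤ n) {f : Fin (2*n) → Fin (2*n)} (hf : IsSP n f)
    {S : Finset (Fin (2*n))} (hS : S ⊂ topSet n f) :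
    fdP (n+1) (raise n f S) = fdP n f +
      if lastPos n hn ∉ S ∧ S ≠ (topSet n f).erase (lastPos n hn) then 1 else 0 := by
  rw [fdP, card_filter_of_forall_lt _ (fun k hk => by omega)]
  have hlast : (∃ k' : Fin (2*n), (k' : ℕ) < 2*n-1 ∧ k' ∈ topSet n f ∧ k' ∉ S) ∧ lastPos n hn ∉ S ↔
      lastPos n hn ∉ S ∧ S ≠ (topSet n f).erase (lastPos n hn) := by
    rw [and_comm]
    refine and_congr_right fun ha => ?_
    constructor
    · rintro ⟨k', h1, h2, h3⟩ h
      refine h3 (h ▸ Finset.mem_erase.2 ⟨?_, h2⟩)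
      simp only [lastPos, ne_eq, Fin.ext_iff]
      omega
    · intro h
      have hsub : S ⊆ (topSet n f).erase (lastPos n hn) := fun x hx =>
        Finset.mem_erase.2 ⟨fun h' => ha (h' ▸ hx), hS.1 hx⟩
      obtain ⟨k', h1, h2⟩ := Finset.exists_of_ssubset (Finset.ssubset_iff_subset_ne.2 ⟨hsub, h⟩)
      rw [Finset.mem_erase] at h1
      refine ⟨k', ?_, h1.2, h2⟩
      have := h1.1
      simp only [lastPos, ne_eq, Fin.ext_iff] at this
      omega
  have key : ∀ k : Fin (2*n),
      ((k : ℕ) + 1 ≤ 2*(n+1) - 2 ∧ (raise n f S ⟨k, by omega⟩ : ℕ) = (k : ℕ) ∧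
        ∃ k' : Fin (2*(n+1)), (k' : ℕ) < (k : ℕ) ∧ raise n f S k' = raise n f S ⟨k, by omega⟩) ↔
      ((k : ℕ) + 1 ≤ 2*n - 2 ∧ (f k : ℕ) = (k : ℕ) ∧
        ∃ k' : Fin (2*n), (k' : ℕ) < (k : ℕ) ∧ f k' = f k) ∨
      (k = lastPos n hn ∧ lastPos n hn ∉ S ∧ S ≠ (topSet n f).erase (lastPos n hn)) := by
    intro k
    have hpar := Nat.even_iff.1 (hf.1 k).1
    by_cases hk : k ∈ S
    · have h1 := mem_topSet.1 (hS.1 hk)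
      rw [raise_val_of_mem f hk]
      constructor
      · intro h
        omega
      · rintro (h | h)
        · omega
        · exact absurd (h.1 ▸ hk) h.2.1
    · have hgk := raise_val_of_notMem f hk
      rw [hgk, ← hlast]
      constructor
      · rintro ⟨-, h1, k', h2, h3⟩
        have h3 := congrArg Fin.val h3
        have hk' : (⟨k', by omega⟩ : Fin (2*n)) ∉ S := by
          intro h
          have := raise_val_of_mem f h
          simp only [Fin.eta] at this
          omega
        have h4 := raise_val_of_notMem f hk'
        simp only [Fin.eta] at h4
        by_cases hka : (k : ℕ) = 2*n-1
        · right
          have hk_eq : k = lastPos n hn := Fin.ext hka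
          refine ⟨hk_eq, ⟨⟨k', by omega⟩, ?_, ?_, hk'⟩, hk_eq ▸ hk⟩
          · simp only
            omega
          · rw [mem_topSet]
            omega
        · left
          refine ⟨by omega, h1, ⟨k', by omega⟩, h2, Fin.ext ?_⟩
          omega
      · rintro (⟨h1, h2, k', h3, h4⟩ | ⟨h1, ⟨k', h2, h3, h4⟩, h5⟩)
        · refine ⟨by omega, h2, ⟨k', by omega⟩, h3, Fin.ext ?_⟩
          rw [hgk, raise_val_of_notMem f, h4]
          intro h
          have := mem_topSet.1 (hS.1 h)
          rw [h4] at this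
          omega
        · have h6 := (hf.1 k).2
          have h7 : (k : ℕ) = 2*n-1 := by rw [h1]; rfl
          rw [mem_topSet] at h3
          refine ⟨by omega, by omega, ⟨k', by omega⟩, ?_, Fin.ext ?_⟩
          · simp only
            omega
          · rw [hgk, raise_val_of_notMem f h4]
            omega
  trans (Finset.univ.filter (fun k : Fin (2*n) => (k : ℕ) + 1 ≤ 2*n - 2 ∧ (f k : ℕ) = (k : ℕ) ∧
        ∃ k' : Fin (2*n), (k' : ℕ) < (k : ℕ) ∧ f k' = f k) ∪
      (if lastPos n hn ∉ S ∧ S ≠ (topSet n f).erase (lastPos n hn) then {lastPos n hn}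
        else ∅)).card
  · congr 1
    ext k
    rw [Finset.mem_union, Finset.mem_filter, Finset.mem_filter]
    simp only [Finset.mem_univ, true_and]
    rw [key k]
    split_ifs with h <;> simp [h]
  · rw [Finset.card_union_of_disjoint]
    · rw [fdP]
      split_ifs <;> simp
    · split_ifs
      · rw [Finset.disjoint_singleton_right, Finset.mem_filter]
        simp only [lastPos]
        omega
      · exact Finset.disjoint_empty_right _

lemma maxP_add_fdP_le {n : ℕ} (hn : 1 ≤ n) :
    ∀ f ∈ SPF n, maxP n f + fdP n f ≤ n - 1 := by
  induction n, hn using Nat.le_induction with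
  | base =>
    intro f _
    simp [maxP, fdP]
  | succ n hn ih =>
    intro g hg
    obtain ⟨f, hf, S, hS, rfl⟩ := exists_raise hn hg
    have h1 := ih f hf
    rw [mem_SPF] at hf
    rw [maxP_raise, fdP_raise hn hf hS]
    have h2 := card_topSet hn hf
    have h3 := Finset.card_lt_card hS
    split_ifs with h
    · have h4 : S ⊂ (topSet n f).erase (lastPos n hn) :=
        Finset.ssubset_iff_subset_ne.2 ⟨fun x hx =>
          Finset.mem_erase.2 ⟨fun h' => h.1 (h' ▸ hx), hS.1 hx⟩, h.2⟩
      have h5 := Finset.card_lt_card h4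
      rw [Finset.card_erase_of_mem (lastPos_mem_topSet hn hf)] at h5
      omega
    · omega

/-! ### Generating functions -/

lemma sum_powerset_pow_card {α R : Type*} [CommSemiring R] (B : Finset α) (y : R) :
    ∑ T ∈ B.powerset, y ^ T.card = (y + 1) ^ B.card := by
  simpa using Finset.sum_pow_mul_eq_add_pow y 1 B

lemma sum_ssubsets_weight {α R : Type*} [DecidableEq α] [CommRing R] {A : Finset α} {a : α}
    (ha : a ∈ A) (y c : R) :
    ∑ S ∈ A.ssubsets, c ^ (if a ∉ S ∧ S ≠ A.erase a then 1 else 0) * y ^ S.card =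
      (y + c) * (y + 1) ^ (A.erase a).card - (y - (1 - c)) * y ^ (A.erase a).card := by
  obtain ⟨B, hB, rfl⟩ : ∃ B, a ∉ B ∧ A = insert a B :=
    ⟨A.erase a, Finset.notMem_erase a A, (Finset.insert_erase ha).symm⟩
  have h1 : ∀ T ∈ B.powerset,
      c ^ (if a ∉ T ∧ T ≠ B then 1 else 0) * y ^ T.card =
        c * y ^ T.card + if T = B then (1 - c) * y ^ T.card else 0 := by
    intro T hT
    have haT : a ∉ T := fun h => hB (Finset.mem_powerset.1 hT h)
    by_cases hTB : T = B
    · simp [hTB]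
      ring
    · simp [hTB, haT]
  have h2 : ∀ T ∈ B.powerset,
      c ^ (if a ∉ insert a T ∧ insert a T ≠ B then 1 else 0) * y ^ (insert a T).card =
        y * y ^ T.card := by
    intro T hT
    have haT : a ∉ T := fun h => hB (Finset.mem_powerset.1 hT h)
    simp [Finset.card_insert_of_notMem haT, pow_succ']
  rw [Finset.ssubsets, Finset.sum_erase_eq_sub (Finset.mem_powerset_self _),
    Finset.sum_powerset_insert hB, Finset.erase_insert hB, Finset.sum_congr rfl h1,
    Finset.sum_congr rfl h2, Finset.sum_add_distrib, ← Finset.mul_sum, ← Finset.mul_sum,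
    sum_powerset_pow_card, Finset.sum_ite_eq', if_pos (Finset.mem_powerset_self B),
    Finset.card_insert_of_notMem hB]
  simp
  ring

lemma C_two_pow_sub {a b c : ℕ} (h : b + c ≤ a) :
    Polynomial.C ((2 : ℚ) ^ (a - b - c)) * Polynomial.X ^ b =
      Polynomial.C ((2 : ℚ) ^ a) * (Polynomial.C (1/2 : ℚ) ^ c *
        (Polynomial.C (1/2 : ℚ) * Polynomial.X) ^ b) := by
  obtain ⟨d, rfl⟩ := Nat.exists_eq_add_of_le h
  rw [show b + c + d - b - c = d by omega, mul_pow, ← Polynomial.C_pow, ← Polynomial.C_pow,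
    ← mul_assoc, ← mul_assoc, ← Polynomial.C_mul, ← Polynomial.C_mul]
  congr 2
  rw [pow_add, pow_add]
  rw [mul_assoc _ ((1/2 : ℚ) ^ c), mul_comm ((1/2 : ℚ) ^ c), one_div, inv_pow, inv_pow]
  field_simp

lemma SPF_one : SPF 1 = {fun _ => ⟨1, by omega⟩} := by
  ext f
  rw [mem_SPF, Finset.mem_singleton]
  constructor
  · intro hf
    funext k
    have h := Nat.even_iff.1 (hf.1 k).1
    exact Fin.ext (by simp only; omega)
  · rintro rfl
    refine ⟨fun k => ⟨⟨1, rfl⟩, by simp only; omega⟩, fun m hm => ⟨m, Fin.ext ?_⟩⟩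
    have h := Nat.even_iff.1 hm
    simp only
    omega

lemma P_eq_sum {n : ℕ} (hn : 1 ≤ n) :
    P n = ∑ f ∈ SPF n, Polynomial.C ((2 : ℚ) ^ (n - 1)) *
      (Polynomial.C (1/2 : ℚ) ^ fdP n f *
        (Polynomial.C (1/2 : ℚ) * Polynomial.X) ^ maxP n f) := by
  induction n, hn using Nat.le_induction with
  | base =>
    rw [SPF_one, Finset.sum_singleton]
    simp [maxP, fdP, P]
  | succ n hn ih =>
    obtain ⟨y, hy⟩ : ∃ y, y = Polynomial.C (1/2 : ℚ) * Polynomial.X := ⟨_, rfl⟩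
    obtain ⟨c, hc⟩ : ∃ c, c = Polynomial.C (1/2 : ℚ) := ⟨_, rfl⟩
    have h2c : 2 * c = 1 := by
      rw [hc, ← Polynomial.C_ofNat, ← Polynomial.C_mul]
      norm_num
    have hX : (Polynomial.X : Polynomial ℚ) = 2 * y := by
      rw [hy, ← hc, ← mul_assoc, h2c, one_mul]
    have hcomp : y.comp (Polynomial.X + 2) = y + 1 := by
      rw [hy, Polynomial.mul_comp, Polynomial.C_comp, Polynomial.X_comp, ← hc]
      linear_combination h2c
    have hrec : P (n+1) = Polynomial.C (1/2 : ℚ) *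
        ((Polynomial.X + 2) * (Polynomial.X + 1) * ((P n).comp (Polynomial.X + 2))
          - Polynomial.X * (Polynomial.X - 1) * (P n)) := by
      obtain ⟨m, rfl⟩ : ∃ m, n = m + 1 := ⟨n - 1, by omega⟩
      rfl
    have hpow : Polynomial.C ((2 : ℚ) ^ (n + 1 - 1)) = 2 * Polynomial.C ((2 : ℚ) ^ (n - 1)) := by
      rw [← Polynomial.C_ofNat, ← Polynomial.C_mul, ← pow_succ']
      congr 2
      omega
    rw [← hy, ← hc] at ih ⊢
    rw [hrec, ih, Polynomial.sum_comp, ← hc, Finset.mul_sum, Finset.mul_sum,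
      ← Finset.sum_sub_distrib, Finset.mul_sum, sum_SPF_succ hn]
    refine Finset.sum_congr rfl fun f hf => ?_
    rw [mem_SPF] at hf
    have hw := sum_ssubsets_weight (lastPos_mem_topSet hn hf) y c
    rw [Finset.card_erase_of_mem (lastPos_mem_topSet hn hf), card_topSet hn hf] at hw
    have hterm : ∀ S ∈ (topSet n f).ssubsets,
        Polynomial.C ((2 : ℚ) ^ (n + 1 - 1)) *
          (c ^ fdP (n+1) (raise n f S) * y ^ maxP (n+1) (raise n f S)) =
        2 * Polynomial.C ((2 : ℚ) ^ (n - 1)) * c ^ fdP n f *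
          (c ^ (if lastPos n hn ∉ S ∧ S ≠ (topSet n f).erase (lastPos n hn) then 1 else 0) *
            y ^ S.card) := by
      intro S hS
      rw [fdP_raise hn hf (Finset.mem_ssubsets.1 hS), maxP_raise, pow_add, hpow]
      ring
    rw [Finset.sum_congr rfl hterm, ← Finset.mul_sum, hw]
    have hcc : c.comp (Polynomial.X + 2) = c := by rw [hc, Polynomial.C_comp]
    simp only [Polynomial.mul_comp, Polynomial.C_comp, Polynomial.pow_comp, hcomp, hcc]
    rw [hX]
    rw [show maxP n f + 2 - 1 = maxP n f + 1 by omega]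
    linear_combination Polynomial.C ((2 : ℚ) ^ (n - 1)) * c ^ fdP n f *
      (2 * y * (y + 1) * (y + 1) ^ maxP n f - 2 * y * (y - 1) * y ^ maxP n f) * h2c

/-- **Formula (5).** For all `n ≥ 1`,
`P_n(x) = Σ_{f ∈ SP_n} 2^{n-1-max(f)-fd(f)} x^{max(f)}`
(in particular `max(f) + fd(f) ≤ n - 1` for every `f ∈ SP_n`). -/
theorem statement19 (n : ℕ) (hn : 1 ≤ n) :
    (∀ f ∈ SPF n, maxP n f + fdP n f ≤ n - 1) ∧
    P n = ∑ f ∈ SPF n,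
      Polynomial.C ((2 : ℚ) ^ (n - 1 - maxP n f - fdP n f)) *
        Polynomial.X ^ (maxP n f) := by
  refine ⟨maxP_add_fdP_le hn, ?_⟩
  rw [P_eq_sum hn]
  exact Finset.sum_congr rfl fun f hf => (C_two_pow_sub (maxP_add_fdP_le hn f hf)).symm

end SymDellac
end
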